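/- arXiv:1712.03448 — 9 statements merged into one kernel-verified Lean document; each statement's English description precedes it below -/
import Mathlib

section
/- Let π be a choice rule with RAM representation (≻, μ). Then for every choice problem S and all distinct a, b ∈ S, π(a|S) − π(a|S−b) ≤ Σ_{T ⊆ S : b ∈ T and a is the ≻-maximal element of T} μ(T|S). -/
open Finset
open scoped Classical

variable {α : Type*} [Fintype α] [DecidableEq α]

/-- A choice rule: for every choice problem (nonempty finite set) `S`,
`π S` is a probability distribution supported on `S`. -/
def IsChoiceRule (π : Finset α → α → ℝ) : Prop :=
  ∀ S : Finset α, S.Nonempty →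
    (∀ a ∈ S, 0 ≤ π S a) ∧ (∀ a, a ∉ S → π S a = 0) ∧ (∑ a ∈ S, π S a) = 1

/-- An attention rule: for every choice problem `S`, `μ S` is a probability
distribution over the nonempty subsets of `S`.  `μ S T` is the probability of
paying attention to the consideration set `T` when the choice problem is `S`. -/
def IsAttentionRule (μ : Finset α → Finset α → ℝ) : Prop :=
  ∀ S : Finset α, S.Nonempty →
    (∀ T : Finset α, T ⊆ S → T.Nonempty → 0 ≤ μ S T) ∧
    (∀ T : Finset α, ¬(T ⊆ S ∧ T.Nonempty) → μ S T = 0) ∧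
    (∑ T ∈ S.powerset, μ S T) = 1

/-- Assumption 1 (Monotonic attention): `μ(T|S) ≤ μ(T|S−a)` for `a ∈ S − T`. -/
def MonotonicAttention (μ : Finset α → Finset α → ℝ) : Prop :=
  ∀ S T : Finset α, S.Nonempty → T ⊆ S → T.Nonempty →
    ∀ a ∈ S, a ∉ T → μ S T ≤ μ (S.erase a) T

/-- A preference: a strict linear order (asymmetric, transitive, complete). -/
structure IsPref (r : α → α → Prop) : Prop where
  asymm : ∀ a b, r a b → ¬ r b a
  trans : ∀ a b c, r a b → r b c → r a c
  total : ∀ a b, a ≠ b → r a b ∨ r b a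

/-- `a` is the `r`-maximal element of `T`. -/
def IsBest (r : α → α → Prop) (a : α) (T : Finset α) : Prop :=
  a ∈ T ∧ ∀ b ∈ T, b ≠ a → r a b

/-- `(r, μ)` represents `π` (without the monotonicity requirement on `μ`):
`π(a|S) = Σ_{T ⊆ S} 1(a is r-best in T) μ(T|S)`. -/
noncomputable def Represents (π : Finset α → α → ℝ) (r : α → α → Prop)
    (μ : Finset α → Finset α → ℝ) : Prop :=
  IsChoiceRule π ∧ IsPref r ∧ IsAttentionRule μ ∧
  ∀ S : Finset α, S.Nonempty → ∀ a ∈ S,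
    π S a = ∑ T ∈ S.powerset, if IsBest r a T then μ S T else 0

/-- `(r, μ)` is a RAM representation of `π`: a representation with `μ` monotonic. -/
def IsRAM (π : Finset α → α → ℝ) (r : α → α → Prop)
    (μ : Finset α → Finset α → ℝ) : Prop :=
  Represents π r μ ∧ MonotonicAttention μ

/-- The revealed-preference relation `P`: `a P b` iff `a ≠ b` and there is a
choice problem `S` containing `a` and `b` with `π(a|S) > π(a|S−b)`. -/
def Prel (π : Finset α → α → ℝ) (a b : α) : Prop :=
  a ≠ b ∧ ∃ S : Finset α, a ∈ S ∧ b ∈ S ∧ π S a > π (S.erase b) a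

/-- Lower contour set of `a` with respect to the preference `r`. -/
noncomputable def lowerContour (r : α → α → Prop) (a : α) : Finset α :=
  Finset.univ.filter fun b => b = a ∨ r a b

/-- An attention rule is triangular w.r.t. `r` if it puts weight only on
(intersections of `S` with) lower contour sets. -/
def Triangular (r : α → α → Prop) (μ : Finset α → Finset α → ℝ) : Prop :=
  ∀ S T : Finset α, S.Nonempty → 0 < μ S T → ∃ a ∈ S, T = lowerContour r a ∩ S

/-- A (deterministic) attention filter. -/
def IsAttentionFilter (Γ : Finset α → Finset α) : Prop :=
  ∀ S : Finset α, S.Nonempty →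
    Γ S ⊆ S ∧ (Γ S).Nonempty ∧
    ∀ a ∈ S, a ∉ Γ S → (S.erase a).Nonempty → Γ (S.erase a) = Γ S

/-- An attention filter is triangular w.r.t. `r` if each `Γ(S)` is the
intersection of `S` with a lower contour set of some element of `S`. -/
def TriangularFilter (r : α → α → Prop) (Γ : Finset α → Finset α) : Prop :=
  ∀ S : Finset α, S.Nonempty → ∃ a ∈ S, Γ S = lowerContour r a ∩ S

/-- Assumption 3 (φ-attentive at binaries). -/
def AttentiveAtBinaries (φ : ℝ) (μ : Finset α → Finset α → ℝ) : Prop :=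
  ∀ a b : α, a ≠ b →
    μ {a, b} {a, b} ≥ (1 - φ) / φ * max (μ {a, b} {a}) (μ {a, b} {b})

/-- A deterministic attention rule. -/
def Deterministic (μ : Finset α → Finset α → ℝ) : Prop :=
  ∀ S T : Finset α, S.Nonempty → μ S T = 0 ∨ μ S T = 1

/-- If `(≻, μ)` is a RAM representation of `π`, then for every
choice problem `S` and distinct `a, b ∈ S`,
`π(a|S) − π(a|S−b) ≤ Σ_{T ⊆ S, b ∈ T, a is ≻-best in T} μ(T|S)`. -/
theorem stmt0 (π : Finset α → α → ℝ) (r : α → α → Prop)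
    (μ : Finset α → Finset α → ℝ) (h : IsRAM π r μ)
    (S : Finset α) (hS : S.Nonempty) (a b : α) (ha : a ∈ S) (hb : b ∈ S)
    (hab : a ≠ b) :
    π S a - π (S.erase b) a ≤
      ∑ T ∈ S.powerset, if b ∈ T ∧ IsBest r a T then μ S T else 0 := by
  obtain ⟨⟨-, -, -, hπ⟩, hμ⟩ := h
  have ha' : a ∈ S.erase b := mem_erase.mpr ⟨hab, ha⟩
  have hfilter : (S.erase b).powerset = S.powerset.filter fun T => b ∉ T := by
    ext T
    simp only [mem_powerset, mem_filter, subset_erase]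
  rw [hπ S hS a ha, hπ _ ⟨a, ha'⟩ a ha', hfilter, sum_filter, ← sum_sub_distrib]
  refine sum_le_sum fun T hT => ?_
  by_cases hbest : IsBest r a T
  · by_cases hbT : b ∈ T
    · simp [hbest, hbT]
    · simpa [hbest, hbT] using hμ S T hS (mem_powerset.mp hT) ⟨a, hbest.1⟩ b hb hbT
  · simp [hbest]
end

section
/- (Lemma 1) Let π be a choice rule that has at least one RAM representation. If there exist a choice problem S and distinct a, b ∈ S with π(a|S) > π(a|S−b), then a is revealed to be preferred to b, i.e., a ≻ b holds in every RAM representation (≻, μ) of π. -/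
open Finset
open scoped Classical

variable {α : Type*} [Fintype α] [DecidableEq α]

/-- If `b` beats `a`, then no set in which `a` is best contains `b`, so under monotonic attention
removing `b` cannot lower the choice probability of `a`. -/
theorem IsRAM.apply_le_erase {π : Finset α → α → ℝ} {r : α → α → Prop}
    {μ : Finset α → Finset α → ℝ} (h : IsRAM π r μ) {S : Finset α} {a b : α}
    (ha : a ∈ S) (hb : b ∈ S) (hab : a ≠ b) (hba : r b a) :
    π S a ≤ π (S.erase b) a := by
  obtain ⟨⟨-, hr, -, hπ⟩, hmono⟩ := h
  have hae : a ∈ S.erase b := Finset.mem_erase.2 ⟨hab, ha⟩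
  rw [hπ S ⟨a, ha⟩ a ha, hπ (S.erase b) ⟨a, hae⟩ a hae, ← Finset.sum_filter,
    ← Finset.sum_filter]
  have notMem : ∀ T, IsBest r a T → b ∉ T := fun T hT hbT =>
    hr.asymm b a hba (hT.2 b hbT hab.symm)
  have filter_eq : S.powerset.filter (IsBest r a) = (S.erase b).powerset.filter (IsBest r a) := by
    ext T
    simp only [Finset.mem_filter, Finset.mem_powerset]
    exact and_congr_left fun hT =>
      ⟨fun hTS => Finset.subset_erase.2 ⟨hTS, notMem T hT⟩,
        fun hTS => hTS.trans (Finset.erase_subset b S)⟩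
  rw [filter_eq]
  refine Finset.sum_le_sum fun T hT => ?_
  obtain ⟨hTS, hT⟩ := Finset.mem_filter.1 hT
  exact hmono S T ⟨a, ha⟩ ((Finset.mem_powerset.1 hTS).trans (Finset.erase_subset b S))
    ⟨a, hT.1⟩ b hb (notMem T hT)

/-- Lemma 1: If `π` has at least one RAM representation and
`π(a|S) > π(a|S−b)` for some choice problem `S` containing distinct `a, b`,
then `a` is revealed to be preferred to `b`: `a ≻ b` in every RAM
representation `(≻, μ)` of `π`. -/
theorem stmt1 (π : Finset α → α → ℝ)
    (hRAM : ∃ (r : α → α → Prop) (μ : Finset α → Finset α → ℝ), IsRAM π r μ)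
    (S : Finset α) (a b : α) (ha : a ∈ S) (hb : b ∈ S) (hab : a ≠ b)
    (hgt : π S a > π (S.erase b) a) :
    ∀ (r : α → α → Prop) (μ : Finset α → Finset α → ℝ), IsRAM π r μ → r a b := by
  intro r μ h
  exact (h.1.2.1.total a b hab).resolve_right fun hba =>
    absurd (h.apply_le_erase ha hb hab hba) (not_le.2 hgt)
end

section
/- (Theorem 1, Revealed Preference) Let π be a choice rule that has at least one RAM representation, and let a, b ∈ X be distinct. Then a is revealed to be preferred to b (i.e., a ≻ b in every RAM representation of π) if and only if a P_R b, where P_R is the transitive closure of the relation P. -/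
open Finset
open scoped Classical

variable {α : Type*} [Fintype α] [DecidableEq α]

/-- Every RAM representation respects the relation `P`. -/
theorem IsRAM.rel_of_prel {π : Finset α → α → ℝ} {r : α → α → Prop}
    {μ : Finset α → Finset α → ℝ} (h : IsRAM π r μ) {a b : α} (hP : Prel π a b) : r a b := by
  obtain ⟨⟨-, hr, hμ, hrep⟩, hmon⟩ := h
  obtain ⟨hab, S, ha, hb, hlt⟩ := hP
  by_contra hn
  have hba : r b a := (hr.total a b hab).resolve_left hn
  have ha' : a ∈ S.erase b := mem_erase.2 ⟨hab, ha⟩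
  rw [hrep S ⟨a, ha⟩ a ha, hrep _ ⟨a, ha'⟩ a ha'] at hlt
  refine absurd hlt (not_lt.2 ?_)
  have hsub : (S.erase b).powerset ⊆ S.powerset := powerset_mono.2 (erase_subset b S)
  rw [← sum_subset hsub]
  · refine sum_le_sum fun T hT => ?_
    split_ifs with hbest
    · have hTS := mem_powerset.1 hT
      exact hmon S T ⟨a, ha⟩ (hTS.trans (erase_subset b S)) ⟨a, hbest.1⟩ b hb
        fun hbT => notMem_erase b S (hTS hbT)
    · exact le_rfl
  · intro T hT hT'
    refine if_neg fun hbest => hT' ?_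
    refine mem_powerset.2 (subset_erase.2 ⟨mem_powerset.1 hT, fun hbT => ?_⟩)
    exact hr.asymm b a hba (hbest.2 b hbT hab.symm)

/-- Every RAM representation respects the transitive closure of `P`. -/
theorem IsRAM.rel_of_transGen {π : Finset α → α → ℝ} {r : α → α → Prop}
    {μ : Finset α → Finset α → ℝ} (h : IsRAM π r μ) {a b : α}
    (hP : Relation.TransGen (Prel π) a b) : r a b := by
  induction hP with
  | single h' => exact h.rel_of_prel h'
  | tail _ h' ih => exact h.1.2.1.trans _ _ _ ih (h.rel_of_prel h')

/-- The triangular attention rule in which the lower contour set of `a` in `S` is considered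
with probability `π S a`. -/
noncomputable def triangularRule (π : Finset α → α → ℝ) (r : α → α → Prop) (S T : Finset α) : ℝ :=
  ∑ a ∈ S, if T = lowerContour r a ∩ S then π S a else 0

theorem mem_lowerContour {r : α → α → Prop} {a b : α} :
    b ∈ lowerContour r a ↔ b = a ∨ r a b := by
  simp [lowerContour]

theorem isBest_lowerContour_inter_iff {r : α → α → Prop} (hr : IsPref r) {S : Finset α} {a c : α}
    (hc : c ∈ S) : IsBest r a (lowerContour r c ∩ S) ↔ a = c := by
  constructor
  · rintro ⟨haT, hbest⟩
    by_contra hac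
    have hcT : c ∈ lowerContour r c ∩ S := mem_inter.2 ⟨mem_lowerContour.2 (.inl rfl), hc⟩
    have hca := (mem_lowerContour.1 (mem_inter.1 haT).1).resolve_left hac
    exact hr.asymm c a hca (hbest c hcT (Ne.symm hac))
  · rintro rfl
    exact ⟨mem_inter.2 ⟨mem_lowerContour.2 (.inl rfl), hc⟩, fun b hb hne =>
      (mem_lowerContour.1 (mem_inter.1 hb).1).resolve_left hne⟩

theorem triangularRule_nonneg {π : Finset α → α → ℝ} (hπ : IsChoiceRule π) (r : α → α → Prop)
    (S T : Finset α) : 0 ≤ triangularRule π r S T := by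
  refine sum_nonneg fun a ha => ?_
  split_ifs
  · exact (hπ S ⟨a, ha⟩).1 a ha
  · exact le_rfl

theorem sum_powerset_triangularRule (π : Finset α → α → ℝ) (r : α → α → Prop) (S : Finset α)
    (p : Finset α → Prop) :
    (∑ T ∈ S.powerset, if p T then triangularRule π r S T else 0) =
      ∑ c ∈ S, if p (lowerContour r c ∩ S) then π S c else 0 := by
  have hswap : (∑ T ∈ S.powerset, if p T then triangularRule π r S T else 0) =
      ∑ T ∈ S.powerset, ∑ c ∈ S,
        if T = lowerContour r c ∩ S then (if p T then π S c else 0) else 0 := by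
    refine sum_congr rfl fun T _ => ?_
    by_cases hp : p T <;> simp [hp, triangularRule]
  rw [hswap, sum_comm]
  refine sum_congr rfl fun c _ => ?_
  rw [sum_ite_eq' S.powerset (lowerContour r c ∩ S) fun T => if p T then π S c else 0,
    if_pos (mem_powerset.2 inter_subset_right)]

theorem isAttentionRule_triangularRule {π : Finset α → α → ℝ} (hπ : IsChoiceRule π)
    (r : α → α → Prop) : IsAttentionRule (triangularRule π r) := by
  refine fun S hS => ⟨fun T _ _ => triangularRule_nonneg hπ r S T, fun T hT => ?_, ?_⟩
  · refine sum_eq_zero fun a ha => if_neg ?_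
    rintro rfl
    exact hT ⟨inter_subset_right, a, mem_inter.2 ⟨mem_lowerContour.2 (.inl rfl), ha⟩⟩
  · simpa [(hπ S hS).2.2] using sum_powerset_triangularRule π r S fun _ => True

theorem monotonicAttention_triangularRule {π : Finset α → α → ℝ} (hπ : IsChoiceRule π)
    {r : α → α → Prop} (hP : ∀ a b, Prel π a b → r a b) :
    MonotonicAttention (triangularRule π r) := by
  intro S T _ _ _ c hc hcT
  have hzero : (if T = lowerContour r c ∩ S then π S c else 0) = 0 := by
    refine if_neg ?_
    rintro rfl
    exact hcT (mem_inter.2 ⟨mem_lowerContour.2 (.inl rfl), hc⟩)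
  rw [triangularRule, ← add_sum_erase S _ hc, hzero, zero_add, triangularRule]
  refine sum_le_sum fun a ha => ?_
  obtain ⟨hac, haS⟩ := mem_erase.1 ha
  by_cases hT : T = lowerContour r a ∩ S
  · have hca : c ∉ lowerContour r a := fun h => hcT (hT ▸ mem_inter.2 ⟨h, hc⟩)
    have hT' : T = lowerContour r a ∩ S.erase c := by
      rw [inter_erase, ← hT, erase_eq_of_notMem hcT]
    rw [if_pos hT, if_pos hT']
    by_contra hlt
    exact hca (mem_lowerContour.2 (.inr (hP a c ⟨hac, S, haS, hc, not_le.1 hlt⟩)))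
  · rw [if_neg hT]
    split_ifs
    · exact (hπ _ ⟨a, ha⟩).1 a ha
    · exact le_rfl

/-- Any preference respecting `P` is part of a RAM representation. -/
theorem isRAM_triangularRule {π : Finset α → α → ℝ} (hπ : IsChoiceRule π)
    {r : α → α → Prop} (hr : IsPref r) (hP : ∀ a b, Prel π a b → r a b) :
    IsRAM π r (triangularRule π r) := by
  refine ⟨⟨hπ, hr, isAttentionRule_triangularRule hπ r, fun S _ a ha => ?_⟩,
    monotonicAttention_triangularRule hπ hP⟩
  rw [sum_powerset_triangularRule π r S (IsBest r a), sum_congr rfl fun c hc => if_congr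
    (isBest_lowerContour_inter_iff hr hc) rfl rfl, sum_ite_eq, if_pos ha]

/-- A relation contained in a preference and whose transitive closure does not relate `a` to `b`
extends to a preference ranking `b` above `a`. -/
theorem exists_isPref_extending {r₀ P : α → α → Prop} (h₀ : IsPref r₀)
    (hP : ∀ a b, P a b → r₀ a b) {a b : α} (hab : a ≠ b) (hn : ¬ Relation.TransGen P a b) :
    ∃ r : α → α → Prop, IsPref r ∧ (∀ x y, P x y → r x y) ∧ r b a := by
  have htrans : ∀ x y, Relation.TransGen P x y → r₀ x y := fun x y h => by
    induction h with
    | single h' => exact hP _ _ h'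
    | tail _ h' ih => exact h₀.trans _ _ _ ih (hP _ _ h')
  have hn' : ¬ Relation.ReflTransGen P a b := fun h =>
    (Relation.reflTransGen_iff_eq_or_transGen.1 h).elim (fun h => hab h.symm) hn
  have hanti : ∀ x y, Relation.ReflTransGen P x y → Relation.ReflTransGen P y x → x = y := by
    intro x y hxy hyx
    rcases Relation.reflTransGen_iff_eq_or_transGen.1 hxy with h | h
    · exact h.symm
    rcases Relation.reflTransGen_iff_eq_or_transGen.1 hyx with h' | h'
    · exact h'
    exact (h₀.asymm x y (htrans _ _ h) (htrans _ _ h')).elim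
  let le : α → α → Prop := fun x y => Relation.ReflTransGen P x y ∨
    (Relation.ReflTransGen P x b ∧ Relation.ReflTransGen P a y)
  have hle : IsPartialOrder α le :=
    { refl := fun x => .inl .refl
      trans := by
        rintro x y z (hxy | ⟨hxb, hay⟩) (hyz | ⟨hyb, haz⟩)
        · exact .inl (hxy.trans hyz)
        · exact .inr ⟨hxy.trans hyb, haz⟩
        · exact .inr ⟨hxb, hay.trans hyz⟩
        · exact .inr ⟨hxb, haz⟩
      antisymm := by
        rintro x y (hxy | ⟨hxb, hay⟩) (hyx | ⟨hyb, hax⟩)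
        · exact hanti x y hxy hyx
        · exact (hn' (hax.trans (hxy.trans hyb))).elim
        · exact (hn' (hay.trans (hyx.trans hxb))).elim
        · exact (hn' (hay.trans hyb)).elim }
  obtain ⟨s, hs, hles⟩ := extend_partialOrder le
  refine ⟨fun x y => s x y ∧ x ≠ y, ⟨?_, ?_, ?_⟩, ?_, ?_⟩
  · exact fun x y h h' => h.2 (hs.antisymm x y h.1 h'.1)
  · rintro x y z ⟨hxy, hne⟩ ⟨hyz, -⟩
    refine ⟨hs.trans x y z hxy hyz, ?_⟩
    rintro rfl
    exact hne (hs.antisymm x y hxy hyz)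
  · exact fun x y hne => (hs.total x y).imp (fun h => ⟨h, hne⟩) fun h => ⟨h, hne.symm⟩
  · refine fun x y h => ⟨hles x y (.inl (.single h)), ?_⟩
    rintro rfl
    exact h₀.asymm x x (hP x x h) (hP x x h)
  · exact ⟨hles b a (.inr ⟨.refl, .refl⟩), hab.symm⟩

/-- Theorem 1, Revealed Preference: If `π` has at least one RAM
representation and `a ≠ b`, then `a` is revealed to be preferred to `b`
(`a ≻ b` in every RAM representation of `π`) iff `a P_R b`, where `P_R` is the
transitive closure of `P`. -/
theorem stmt2 (π : Finset α → α → ℝ)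
    (hRAM : ∃ (r : α → α → Prop) (μ : Finset α → Finset α → ℝ), IsRAM π r μ)
    (a b : α) (hab : a ≠ b) :
    (∀ (r : α → α → Prop) (μ : Finset α → Finset α → ℝ), IsRAM π r μ → r a b) ↔
      Relation.TransGen (Prel π) a b := by
  refine ⟨fun h => ?_, fun h r μ hr => hr.rel_of_transGen h⟩
  obtain ⟨r₀, μ₀, h₀⟩ := hRAM
  by_contra hn
  obtain ⟨r, hr, hP, hba⟩ :=
    exists_isPref_extending h₀.1.2.1 (fun _ _ => h₀.rel_of_prel) hab hn
  exact hr.asymm b a hba (h r _ (isRAM_triangularRule h₀.1.1 hr hP))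
end

section
/- Let φ ∈ [1/2, 1] and let (≻, μ) be a RAM representation of the choice rule π in which μ is additionally φ-attentive at binaries (Assumption 3). If π(a|{a,b}) > φ for distinct a, b ∈ X, then a ≻ b. -/
open Finset
open scoped Classical

variable {α : Type*} [Fintype α] [DecidableEq α]

/-- If `(≻, μ)` is a RAM representation of `π` with `μ`
φ-attentive at binaries (φ ∈ [1/2, 1]), and `π(a|{a,b}) > φ` for distinct
`a, b`, then `a ≻ b`. -/
theorem stmt7 (φ : ℝ) (hφ1 : 1 / 2 ≤ φ) (hφ2 : φ ≤ 1)
    (π : Finset α → α → ℝ) (r : α → α → Prop) (μ : Finset α → Finset α → ℝ)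
    (h : IsRAM π r μ) (hatt : AttentiveAtBinaries φ μ)
    (a b : α) (hab : a ≠ b) (hgt : π {a, b} a > φ) :
    r a b := by
  by_contra hr
  obtain ⟨⟨-, hpref, hatt_rule, hrep⟩, -⟩ := h
  have hba : r b a := (hpref.total a b hab).resolve_left hr
  have hne : ({a, b} : Finset α).Nonempty := ⟨a, by simp⟩
  obtain ⟨hnonneg, hzero, hsum⟩ := hatt_rule {a, b} hne
  have hempty : μ {a, b} ∅ = 0 := hzero ∅ (by simp)
  have hμb : 0 ≤ μ {a, b} {b} := hnonneg {b} (by simp) (by simp)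
  have hπ : π {a, b} a = μ {a, b} {a} := by
    rw [hrep {a, b} hne a (by simp), Finset.sum_eq_single {a}]
    · rw [if_pos]
      exact ⟨by simp, fun c hc hca => absurd (by simpa using hc) hca⟩
    · intro T hT hTa
      rw [if_neg]
      rintro ⟨haT, hbest⟩
      refine hTa (Finset.eq_singleton_iff_unique_mem.2 ⟨haT, fun c hc => ?_⟩)
      by_contra hca
      have hcb : c = b := by
        have := Finset.mem_powerset.1 hT hc
        simp only [Finset.mem_insert, Finset.mem_singleton] at this
        exact this.resolve_left hca
      subst hcb
      exact hr (hbest c hc hca)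
    · simp
  have htotal : μ {a, b} {a} + μ {a, b} {b} + μ {a, b} {a, b} = 1 := by
    have hnot : a ∉ ({b} : Finset α) := by simpa using hab
    have hsplit : ∑ T ∈ ({a, b} : Finset α).powerset, μ {a, b} T =
        μ {a, b} ∅ + μ {a, b} {b} + (μ {a, b} {a} + μ {a, b} {a, b}) := by
      rw [Finset.sum_powerset_insert hnot, ← insert_empty_eq b,
        Finset.sum_powerset_insert (Finset.notMem_empty b),
        Finset.sum_powerset_insert (Finset.notMem_empty b)]
      simp
    linarith
  have hφ : 0 < φ := by linarith
  have hcoef : 0 ≤ (1 - φ) / φ := div_nonneg (by linarith) hφ.le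
  have hab_ge : 1 - φ ≤ μ {a, b} {a, b} :=
    calc 1 - φ = (1 - φ) / φ * φ := by field_simp
      _ ≤ (1 - φ) / φ * max (μ {a, b} {a}) (μ {a, b} {b}) :=
        mul_le_mul_of_nonneg_left (le_max_of_le_left (by linarith)) hcoef
      _ ≤ μ {a, b} {a, b} := hatt a b hab
  linarith
end

section
/- (φ-acyclic stochastic transitivity) Fix φ ∈ [1/2, 1] and suppose the choice rule π has a RAM representation (≻, μ) in which μ is monotonic and φ-attentive at binaries. Then for any finite sequence of distinct alternatives a_1, a_2, …, a_k with π(a_i|{a_i, a_{i+1}}) > φ for all i = 1, …, k−1, it holds that π(a_k|{a_1, a_k}) ≤ φ. -/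
open Finset
open scoped Classical

variable {α : Type*} [Fintype α] [DecidableEq α]

/-- With attentive binaries, an alternative chosen from a pair with probability above `φ`
is preferred to the other one. -/
theorem pref_of_lt_choice {φ : ℝ} (hφ : 0 < φ) {π : Finset α → α → ℝ} {r : α → α → Prop}
    {μ : Finset α → Finset α → ℝ} (h : Represents π r μ) (hatt : AttentiveAtBinaries φ μ)
    {a b : α} (hab : a ≠ b) (hlt : φ < π {a, b} a) : r a b := by
  obtain ⟨-, hr, hμ, hπ⟩ := h
  refine (hr.total a b hab).resolve_right fun hba => hlt.not_ge ?_
  obtain ⟨hnonneg, hzero, hsum⟩ := hμ {a, b} (insert_nonempty a {b})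
  have hchoice : π {a, b} a = μ {a, b} {a} := by
    rw [hπ {a, b} (insert_nonempty a {b}) a (mem_insert_self a {b}),
      Finset.sum_eq_single {a}]
    · exact if_pos ⟨mem_singleton_self a, fun c hc hca => absurd (mem_singleton.1 hc) hca⟩
    · intro T hT hTa
      refine if_neg fun hbest => hTa ?_
      refine eq_singleton_iff_unique_mem.2 ⟨hbest.1, fun c hc => ?_⟩
      by_contra hca
      have hcb : c = b := by
        simpa [hca] using mem_powerset.1 hT hc
      subst hcb
      exact hr.asymm _ _ hba (hbest.2 c hc hca)
    · intro hnot
      exact absurd (mem_powerset.2 (by simp)) hnot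
  have hne : ({a} : Finset α) ≠ {a, b} := by
    intro heq
    have hb : b ∈ ({a} : Finset α) := heq ▸ by simp
    exact hab (mem_singleton.1 hb).symm
  have hle : μ {a, b} {a} + μ {a, b} {a, b} ≤ 1 := by
    rw [← hsum, ← Finset.sum_pair hne]
    refine Finset.sum_le_sum_of_subset_of_nonneg ?_ fun T hT _ => ?_
    · intro T hT
      rcases mem_insert.1 hT with rfl | hT
      · simp
      · simp [mem_singleton.1 hT]
    · by_cases hT' : T.Nonempty
      · exact hnonneg T (mem_powerset.1 hT) hT'
      · exact (hzero T fun h => hT' h.2).ge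
  by_cases hφ1 : φ ≤ 1
  · have hmul : (1 - φ) / φ * μ {a, b} {a} ≤ μ {a, b} {a, b} :=
      (mul_le_mul_of_nonneg_left (le_max_left _ _)
        (div_nonneg (sub_nonneg.2 hφ1) hφ.le)).trans (hatt a b hab)
    have hdiv : μ {a, b} {a} / φ ≤ 1 := by
      have : μ {a, b} {a} / φ = μ {a, b} {a} + (1 - φ) / φ * μ {a, b} {a} := by
        field_simp
        ring
      linarith
    rw [hchoice]
    simpa using (div_le_iff₀ hφ).1 hdiv
  · have := hnonneg {a, b} Subset.rfl (insert_nonempty a {b})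
    linarith

/-- φ-acyclic stochastic transitivity: If `π` has a RAM
representation `(≻, μ)` with `μ` monotonic and φ-attentive at binaries
(φ ∈ [1/2, 1]), then for any sequence of distinct alternatives
`a 0, …, a (k-1)` (with `k ≥ 2`) such that `π(a i|{a i, a (i+1)}) > φ` for all
consecutive pairs, we must have `π(a (k-1)|{a 0, a (k-1)}) ≤ φ`. -/
theorem stmt9 (φ : ℝ) (hφ1 : 1 / 2 ≤ φ) (hφ2 : φ ≤ 1)
    (π : Finset α → α → ℝ) (r : α → α → Prop) (μ : Finset α → Finset α → ℝ)
    (h : IsRAM π r μ) (hatt : AttentiveAtBinaries φ μ)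
    (k : ℕ) (hk : 2 ≤ k) (a : Fin k → α) (hinj : Function.Injective a)
    (hchain : ∀ i : ℕ, (hi : i + 1 < k) →
      π {a ⟨i, by omega⟩, a ⟨i + 1, hi⟩} (a ⟨i, by omega⟩) > φ) :
    π {a ⟨0, by omega⟩, a ⟨k - 1, by omega⟩} (a ⟨k - 1, by omega⟩) ≤ φ := by
  have hφ : 0 < φ := by linarith
  have hstep : ∀ i : ℕ, (hi : i + 1 < k) → r (a ⟨i, by omega⟩) (a ⟨i + 1, hi⟩) :=
    fun i hi => pref_of_lt_choice hφ h.1 hatt (hinj.ne (by simp)) (hchain i hi)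
  have hfirst : ∀ i : ℕ, (hi : i + 1 < k) → r (a ⟨0, by omega⟩) (a ⟨i + 1, hi⟩) := by
    intro i
    induction i with
    | zero => exact hstep 0
    | succ i ih =>
      exact fun hi => h.1.2.1.trans _ _ _ (ih (by omega)) (hstep (i + 1) hi)
  obtain ⟨m, rfl⟩ : ∃ m, k = m + 2 := ⟨k - 2, by omega⟩
  refine le_of_not_gt fun hlt => h.1.2.1.asymm _ _ (hfirst m (by omega)) ?_
  refine pref_of_lt_choice hφ h.1 hatt (hinj.ne (by simp)) ?_
  rw [pair_comm]
  exact hlt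
end

section
/- (Theorem 6, Random Attention Filter) Fix a preference ≻ on X. For any attention rule μ that is monotonic and triangular with respect to ≻, there exists a probability distribution ψ on the set of attention filters that are triangular with respect to ≻ (a finite set) such that for every choice problem S and every nonempty T ⊆ S, μ(T|S) = Σ_{Γ triangular attention filter} 1(Γ(S) = T)·ψ(Γ). -/
open Finset
open scoped Classical

variable {α : Type*} [Fintype α] [DecidableEq α]

/-- `T` is a nonempty lower segment of `S`: everything in `S` outside `T` is strictly
preferred to everything in `T`. -/
def IsLowerSegment (r : α → α → Prop) (T S : Finset α) : Prop :=
  T.Nonempty ∧ T ⊆ S ∧ ∀ a ∈ T, ∀ b ∈ S, b ∉ T → r b a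

namespace IsLowerSegment

variable {α : Type*} {r : α → α → Prop} {S S' T T' : Finset α}

theorem refl (hS : S.Nonempty) : IsLowerSegment r S S :=
  ⟨hS, Subset.rfl, fun _ _ _ hb hb' => absurd hb hb'⟩

theorem mono (h : IsLowerSegment r T S) (hT : T ⊆ S') (hS : S' ⊆ S) :
    IsLowerSegment r T S' :=
  ⟨h.1, hT, fun a ha b hb hb' => h.2.2 a ha b (hS hb) hb'⟩

theorem subset_or_subset (hr : ∀ a b, r a b → ¬ r b a)
    (h : IsLowerSegment r T S) (h' : IsLowerSegment r T' S) : T ⊆ T' ∨ T' ⊆ T := by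
  by_contra! hc
  obtain ⟨⟨a, ha, ha'⟩, ⟨b, hb, hb'⟩⟩ :=
    And.intro (Finset.not_subset.1 hc.1) (Finset.not_subset.1 hc.2)
  exact hr _ _ (h.2.2 a ha b (h'.2.1 hb) hb') (h'.2.2 b hb a (h.2.1 ha) ha')

end IsLowerSegment

theorem IsPref.exists_best {α : Type*} {r : α → α → Prop} (hr : IsPref r) {T : Finset α}
    (hT : T.Nonempty) : ∃ a ∈ T, ∀ b ∈ T, b = a ∨ r a b := by
  induction hT using Finset.Nonempty.cons_induction with
  | singleton a => exact ⟨a, by simp, by simp⟩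
  | cons c s hc hs ih =>
    obtain ⟨a, ha, hab⟩ := ih
    have hca : c ≠ a := by rintro rfl; exact hc ha
    rcases hr.total c a hca with h | h
    · refine ⟨c, by simp, fun b hb => ?_⟩
      rcases Finset.mem_cons.1 hb with rfl | hb
      · exact Or.inl rfl
      · rcases hab b hb with rfl | h'
        · exact Or.inr h
        · exact Or.inr (hr.trans _ _ _ h h')
    · refine ⟨a, by simp [ha], fun b hb => ?_⟩
      rcases Finset.mem_cons.1 hb with rfl | hb
      · exact Or.inr h
      · exact hab b hb

theorem isLowerSegment_iff {r : α → α → Prop} (hr : IsPref r) {T S : Finset α} :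
    IsLowerSegment r T S ↔ ∃ a ∈ S, T = lowerContour r a ∩ S := by
  constructor
  · rintro ⟨hT, hTS, h⟩
    obtain ⟨a, ha, hab⟩ := hr.exists_best hT
    refine ⟨a, hTS ha, ?_⟩
    ext b
    simp only [lowerContour, mem_inter, mem_filter, mem_univ, true_and]
    refine ⟨fun hb => ⟨hab b hb, hTS hb⟩, fun ⟨hb, hbS⟩ => ?_⟩
    by_contra hbT
    rcases hb with rfl | hb
    · exact hbT ha
    · exact hr.asymm _ _ hb (h a ha b hbS hbT)
  · rintro ⟨a, ha, rfl⟩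
    refine ⟨⟨a, by simp [lowerContour, ha]⟩, inter_subset_right, fun c hc b hb hb' => ?_⟩
    simp only [lowerContour, mem_inter, mem_filter, mem_univ, true_and, hb, and_true,
      not_or] at hc hb'
    have hba : r b a := (hr.total b a hb'.1).resolve_right hb'.2
    rcases hc.1 with rfl | hc
    · exact hba
    · exact hr.trans _ _ _ hba hc

/-- Given for each `T` a collection `D T` of choice problems in which `T` is retained, `T` is
self-attentive if no proper lower segment of `T` captures the attention at `T`. -/
def SelfAttentive {α : Type*} (r : α → α → Prop) (D : Finset α → Finset (Finset α))
    (T : Finset α) : Prop :=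
  ∀ T', ∀ _ : T' ⊂ T, IsLowerSegment r T' T → SelfAttentive r D T' → T ∉ D T'
termination_by T.card
decreasing_by exact Finset.card_lt_card ‹_›

theorem selfAttentive_congr {α : Type*} {r : α → α → Prop} {D D' : Finset α → Finset (Finset α)}
    (T : Finset α) (h : ∀ T' ⊂ T, D T' = D' T') :
    SelfAttentive r D T ↔ SelfAttentive r D' T := by
  induction T using Finset.strongInduction with
  | H T ih =>
    rw [SelfAttentive, SelfAttentive]
    refine forall_congr' fun T' => forall_congr' fun hT' => ?_
    have hiff := ih T' hT' fun R hR => h R (hR.trans hT')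
    have hD := h T' hT'
    simp only [hiff, hD]

/-- The set `T` is considered at the choice problem `S`. -/
def Considered {α : Type*} (r : α → α → Prop) (D : Finset α → Finset (Finset α))
    (S T : Finset α) : Prop :=
  IsLowerSegment r T S ∧ SelfAttentive r D T ∧ (S = T ∨ S ∈ D T)

/-- Retention of `T` at `S` persists when alternatives of `S` outside `T` are removed. -/
def Persistent {α : Type*} (r : α → α → Prop) (D : Finset α → Finset (Finset α)) : Prop :=
  ∀ T S S' : Finset α, IsLowerSegment r T S → T ⊆ S' → S' ⊆ S → S ∈ D T → S' ∈ D T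

theorem exists_considered {α : Type*} (r : α → α → Prop) (D : Finset α → Finset (Finset α))
    {S : Finset α} (hS : S.Nonempty) : ∃ T, Considered r D S T := by
  by_cases h : SelfAttentive r D S
  · exact ⟨S, .refl hS, h, Or.inl rfl⟩
  · rw [SelfAttentive] at h
    push Not at h
    obtain ⟨T, -, hT, hT', hST⟩ := h
    exact ⟨T, hT, hT', Or.inr hST⟩

namespace Persistent

variable {α : Type*} {r : α → α → Prop} {D : Finset α → Finset (Finset α)} {S S' T T' : Finset α}

theorem not_considered_of_ssubset (hD : Persistent r D) (h : Considered r D S T)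
    (h' : Considered r D S T') : ¬ T ⊂ T' := by
  intro hTT
  have hS : S ∈ D T := h.2.2.resolve_left fun e => (e ▸ hTT).not_subset h'.1.2.1
  have hg := h'.2.1
  rw [SelfAttentive] at hg
  exact hg T hTT (h.1.mono hTT.subset h'.1.2.1) h.2.1
    (hD T S T' h.1 hTT.subset h'.1.2.1 hS)

theorem considered_unique (hD : Persistent r D) (hr : ∀ a b, r a b → ¬ r b a)
    (h : Considered r D S T) (h' : Considered r D S T') : T = T' := by
  by_contra hne
  rcases h.1.subset_or_subset hr h'.1 with hs | hs
  · exact hD.not_considered_of_ssubset h h' (hs.ssubset_of_ne hne)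
  · exact hD.not_considered_of_ssubset h' h (hs.ssubset_of_ne (Ne.symm hne))

theorem considered_mono (hD : Persistent r D) (h : Considered r D S T) (hT : T ⊆ S')
    (hS : S' ⊆ S) : Considered r D S' T := by
  refine ⟨h.1.mono hT hS, h.2.1, ?_⟩
  rcases h.2.2 with rfl | hm
  · exact Or.inl (hS.antisymm hT)
  · exact Or.inr (hD T S S' h.1 hT hS hm)

end Persistent

/-- The consideration set mapping induced by the retention collections `D`. -/
noncomputable def inducedFilter {α : Type*} (r : α → α → Prop) (D : Finset α → Finset (Finset α))
    (S : Finset α) : Finset α :=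
  if h : ∃ T, Considered r D S T then h.choose else ∅

theorem considered_inducedFilter {α : Type*} (r : α → α → Prop)
    (D : Finset α → Finset (Finset α)) {S : Finset α} (hS : S.Nonempty) :
    Considered r D S (inducedFilter r D S) := by
  have h := exists_considered r D hS
  rw [inducedFilter, dif_pos h]
  exact h.choose_spec

theorem Persistent.inducedFilter_eq_iff {α : Type*} {r : α → α → Prop}
    {D : Finset α → Finset (Finset α)} (hD : Persistent r D) (hr : ∀ a b, r a b → ¬ r b a)
    {S T : Finset α} (hS : S.Nonempty) : inducedFilter r D S = T ↔ Considered r D S T :=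
  ⟨fun h => h ▸ considered_inducedFilter r D hS,
    fun h => hD.considered_unique hr (considered_inducedFilter r D hS) h⟩

theorem Persistent.isAttentionFilter {α : Type*} [DecidableEq α] {r : α → α → Prop} {D : Finset α → Finset (Finset α)}
    (hD : Persistent r D) (hr : ∀ a b, r a b → ¬ r b a) :
    IsAttentionFilter (inducedFilter r D) := by
  intro S hS
  have h := considered_inducedFilter r D hS
  refine ⟨h.1.2.1, h.1.1, fun a _ ha hne => (hD.inducedFilter_eq_iff hr hne).2 ?_⟩
  exact hD.considered_mono h (Finset.subset_erase.2 ⟨h.1.2.1, ha⟩) (Finset.erase_subset _ _)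

/-- A `[0,1]`-valued function on a finite type is the coverage function of a random superlevel
set. -/
theorem exists_superlevel_weights {β : Type*} [Fintype β] [DecidableEq β] (q : β → ℝ) (hq0 : ∀ s, 0 ≤ q s)
    (hq1 : ∀ s, q s ≤ 1) :
    ∃ w : Finset β → ℝ, (∀ D, 0 ≤ w D) ∧ (∑ D, w D = 1) ∧
      (∀ D, w D ≠ 0 → ∀ s s', s ∈ D → q s ≤ q s' → s' ∈ D) ∧
      ∀ s, (∑ D, if s ∈ D then w D else 0) = q s := by
  let P : MeasureTheory.Measure ℝ := MeasureTheory.volume.restrict (Set.Ioc 0 1)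
  let f : ℝ → Finset β := fun v => Finset.univ.filter fun s => v ≤ q s
  have hf : ∀ D, MeasurableSet (f ⁻¹' {D}) := by
    intro D
    have : f ⁻¹' {D} = ⋂ s, {v : ℝ | v ≤ q s ↔ s ∈ D} := by
      ext v
      simp [f, Finset.ext_iff]
    rw [this]
    refine MeasurableSet.iInter fun s => ?_
    by_cases h : s ∈ D
    · simp only [h, iff_true]
      exact measurableSet_Iic
    · simp only [h, iff_false, not_le]
      exact measurableSet_Ioi
  have hsum : ∀ A : Finset (Finset β),
      ∑ D ∈ A, P.real (f ⁻¹' {D}) = P.real (f ⁻¹' (A : Set (Finset β))) := fun A =>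
    MeasureTheory.sum_measureReal_preimage_singleton A fun D _ => hf D
  refine ⟨fun D => P.real (f ⁻¹' {D}), fun D => MeasureTheory.measureReal_nonneg, ?_, ?_, ?_⟩
  · rw [hsum]
    simp [P, MeasureTheory.measureReal_def]
  · intro D hD s s' hs hss
    have hne : (f ⁻¹' {D}).Nonempty := by
      by_contra hne
      rw [Set.not_nonempty_iff_eq_empty] at hne
      exact hD (by simp [hne])
    obtain ⟨v, rfl⟩ := hne
    simp only [f, mem_filter, mem_univ, true_and] at hs ⊢
    exact hs.trans hss
  · intro s
    rw [← Finset.sum_filter, hsum]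
    have : f ⁻¹' ((Finset.univ.filter fun D => s ∈ D : Finset (Finset β)) : Set (Finset β))
        = Set.Iic (q s) := by
      ext v
      simp [f]
    rw [this, MeasureTheory.measureReal_restrict_apply measurableSet_Iic, Set.inter_comm,
      Set.Ioc_inter_Iic, min_eq_right (hq1 s)]
    simp [MeasureTheory.measureReal_def, hq0 s]

/-- Under a product weight, a function not depending on the coordinate `i` is uncorrelated with
any function of the coordinate `i`. -/
theorem sum_mul_apply_mul_prod {ι κ : Type*} [Fintype ι] [DecidableEq ι] [Fintype κ]
    (w : ι → κ → ℝ) (i : ι) (hw : ∑ d, w i d = 1) (g : (ι → κ) → ℝ) (h : κ → ℝ)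
    (hg : ∀ D d, g (Function.update D i d) = g D) :
    ∑ D : ι → κ, g D * h (D i) * ∏ j, w j (D j) =
      (∑ D : ι → κ, g D * ∏ j, w j (D j)) * ∑ d, h d * w i d := by
  have hW : ∀ (D : ι → κ) (d : κ),
      (∏ j, w j (Function.update D i d j)) * w i (D i) = (∏ j, w j (D j)) * w i d := by
    intro D d
    rw [← Finset.mul_prod_erase _ (fun j => w j (D j)) (Finset.mem_univ i),
      ← Finset.mul_prod_erase _ _ (Finset.mem_univ i)]
    rw [Finset.prod_congr rfl fun j hj => by
      rw [Function.update_of_ne (Finset.ne_of_mem_erase hj)]]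
    simp only [Function.update_self]
    ring
  have key : ∑ x : (ι → κ) × κ, g x.1 * h (x.1 i) * (∏ j, w j (x.1 j)) * w i x.2 =
      ∑ x : (ι → κ) × κ, g x.1 * h x.2 * (∏ j, w j (x.1 j)) * w i x.2 := by
    have hinv : Function.Involutive
        fun x : (ι → κ) × κ => (Function.update x.1 i x.2, x.1 i) := by
      intro x
      simp
    refine Fintype.sum_equiv hinv.toPerm _ _ fun x => ?_
    simp only [Function.Involutive.coe_toPerm, hg, mul_assoc, hW]
  rw [Fintype.sum_prod_type, Fintype.sum_prod_type] at key
  simp only [← Finset.mul_sum, hw, mul_one] at key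
  rw [key, Finset.sum_mul]
  refine Finset.sum_congr rfl fun D _ => ?_
  rw [Finset.mul_sum]
  refine Finset.sum_congr rfl fun d _ => ?_
  ring

theorem MonotonicAttention.antitone {α : Type*} [DecidableEq α] {μ : Finset α → Finset α → ℝ} (hmono : MonotonicAttention μ)
    {S S' T : Finset α} (hT : T.Nonempty) (hTS : T ⊆ S') (hS : S' ⊆ S) : μ S T ≤ μ S' T := by
  induction S using Finset.strongInduction with
  | H S ih =>
    rcases hS.eq_or_ssubset with rfl | hss
    · exact le_rfl
    · obtain ⟨a, haS, hna⟩ := Finset.exists_of_ssubset hss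
      have hTS0 := hTS.trans hS
      exact (hmono S T (hT.mono hTS0) hTS0 hT a haS fun h => hna (hTS h)).trans
        (ih _ (Finset.erase_ssubset haS) (Finset.subset_erase.2 ⟨hS, hna⟩))

/-- The ingredients of the random attention filter: independent random retention collections
whose coverage is the conditional probability of keeping `T` at `S` given it is kept at `T`. -/
theorem exists_retention_weights {r : α → α → Prop} {μ : Finset α → Finset α → ℝ}
    (hμ : IsAttentionRule μ) (hmono : MonotonicAttention μ) :
    ∃ w : Finset α → Finset (Finset α) → ℝ, (∀ T D, 0 ≤ w T D) ∧ (∀ T, ∑ D, w T D = 1) ∧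
      (∀ D : Finset α → Finset (Finset α), (∀ T, w T (D T) ≠ 0) → Persistent r D) ∧
      ∀ T S, IsLowerSegment r T S →
        μ T T * (∑ D, (if S ∈ D then 1 else 0) * w T D) = μ S T := by
  let q : Finset α → Finset α → ℝ := fun T S => if IsLowerSegment r T S then μ S T / μ T T else 0
  have h0 : ∀ {T S : Finset α}, IsLowerSegment r T S → 0 ≤ μ S T := fun h =>
    (hμ _ (h.1.mono h.2.1)).1 _ h.2.1 h.1
  have hle : ∀ {T S : Finset α}, IsLowerSegment r T S → μ S T ≤ μ T T := fun h =>
    hmono.antitone h.1 Subset.rfl h.2.1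
  have hex := fun T => exists_superlevel_weights (q T)
    (fun S => by
      by_cases h : IsLowerSegment r T S
      · simpa [q, h] using div_nonneg (h0 h) (h0 (.refl h.1))
      · simp [q, h])
    (fun S => by
      by_cases h : IsLowerSegment r T S
      · simpa [q, h] using div_le_one_of_le₀ (hle h) (h0 (.refl h.1))
      · simp [q, h])
  choose w hw0 hw1 hw hwq using hex
  refine ⟨w, hw0, hw1, fun D hD T S S' hTS hT hS hSD => ?_, fun T S h => ?_⟩
  · refine hw T (D T) (hD T) S S' hSD ?_
    simp only [q, if_pos hTS, if_pos (hTS.mono hT hS)]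
    exact div_le_div_of_nonneg_right (hmono.antitone hTS.1 hT hS) (h0 (.refl hTS.1))
  · simp only [ite_mul, one_mul, zero_mul, hwq, q, if_pos h]
    by_cases hz : μ T T = 0
    · rw [hz, zero_mul]
      exact (h0 h).antisymm (hz ▸ hle h)
    · exact mul_div_cancel₀ _ hz

/-- `T` is considered at `S` with probability `μ S T` under the product of the retention
weights. -/
theorem sum_considered_eq {r : α → α → Prop} (hr : IsPref r) {μ : Finset α → Finset α → ℝ}
    (hμ : IsAttentionRule μ) (htri : Triangular r μ)
    (w : Finset α → Finset (Finset α) → ℝ) (hw1 : ∀ T, ∑ D, w T D = 1)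
    (hw : ∀ D : Finset α → Finset (Finset α), (∀ T, w T (D T) ≠ 0) → Persistent r D)
    (hwμ : ∀ T S, IsLowerSegment r T S →
      μ T T * (∑ D, (if S ∈ D then 1 else 0) * w T D) = μ S T)
    {S : Finset α} (hS : S.Nonempty) (T : Finset α) :
    ∑ D : Finset α → Finset (Finset α), (if Considered r D S T then ∏ R, w R (D R) else 0) =
      μ S T := by
  have hμ0 : ∀ {S T : Finset α}, S.Nonempty → ¬ IsLowerSegment r T S → μ S T = 0 := by
    intro S T hS h
    by_contra hne
    by_cases hT : T ⊆ S ∧ T.Nonempty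
    · exact h ((isLowerSegment_iff hr).2
        (htri S T hS (((hμ S hS).1 T hT.1 hT.2).lt_of_ne' hne)))
    · exact hne ((hμ S hS).2.1 T hT)
  have hμ1 : ∀ {S : Finset α}, S.Nonempty → ∑ T, μ S T = 1 := by
    intro S hS
    rw [← (hμ S hS).2.2]
    refine (Finset.sum_subset (Finset.subset_univ _) fun T _ hT => ?_).symm
    exact (hμ S hS).2.1 T fun h => hT (Finset.mem_powerset.2 h.1)
  have htotal : ∀ {S : Finset α}, S.Nonempty → ∑ T, ∑ D : Finset α → Finset (Finset α),
      (if Considered r D S T then ∏ R, w R (D R) else 0) = 1 := by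
    intro S hS
    have hprod : ∑ D : Finset α → Finset (Finset α), ∏ R, w R (D R) = 1 := by
      rw [← Fintype.prod_sum]
      simp [hw1]
    rw [Finset.sum_comm, ← hprod]
    refine Finset.sum_congr rfl fun D _ => ?_
    by_cases hD : ∏ R, w R (D R) = 0
    · simp [hD]
    · have hp := hw D fun T => Finset.prod_ne_zero_iff.1 hD T (Finset.mem_univ T)
      simp [← hp.inducedFilter_eq_iff hr.asymm hS]
  have hstep : ∀ T : Finset α, T.Nonempty →
      ∑ D : Finset α → Finset (Finset α), (if Considered r D T T then ∏ R, w R (D R) else 0) =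
        μ T T → ∀ S,
      ∑ D : Finset α → Finset (Finset α), (if Considered r D S T then ∏ R, w R (D R) else 0) =
        μ S T ∨ S = ∅ := by
    intro T hT hTT S
    rcases S.eq_empty_or_nonempty with rfl | hS
    · exact Or.inr rfl
    left
    by_cases hTS : IsLowerSegment r T S
    · by_cases hne : S = T
      · rw [hne, hTT]
      · have hind := sum_mul_apply_mul_prod w T (hw1 T)
          (fun D => if SelfAttentive r D T then 1 else 0)
          (fun d => if S ∈ d then 1 else 0) (fun D d => by
            simp only [selfAttentive_congr (r := r) (D := Function.update D T d) (D' := D) T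
              fun T' hT' => Function.update_of_ne hT'.ne _ _])
        have hTT' : ∑ D : Finset α → Finset (Finset α),
            (if SelfAttentive r D T then 1 else 0) * ∏ R, w R (D R) = μ T T := by
          simpa [Considered, IsLowerSegment.refl hT] using hTT
        rw [hTT', hwμ T S hTS] at hind
        rw [← hind]
        refine Finset.sum_congr rfl fun D _ => ?_
        by_cases h1 : SelfAttentive r D T <;> by_cases h2 : S ∈ D T <;>
          simp [Considered, hTS, hne, h1, h2]
    · simp [Considered, hTS, hμ0 hS hTS]
  have hdiag : ∀ T : Finset α, T.Nonempty →
      ∑ D : Finset α → Finset (Finset α), (if Considered r D T T then ∏ R, w R (D R) else 0) =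
        μ T T := by
    intro T
    induction T using Finset.strongInduction with
    | H T ih =>
      intro hT
      have h1 := (htotal hT).trans (hμ1 hT).symm
      rw [← Finset.add_sum_erase _ _ (Finset.mem_univ T),
        ← Finset.add_sum_erase _ (fun R => μ T R) (Finset.mem_univ T)] at h1
      refine add_right_cancel (h1.trans (congrArg _ (Finset.sum_congr rfl fun R hR => ?_)))
      by_cases hRT : IsLowerSegment r R T
      · have hss := hRT.2.1.ssubset_of_ne (Finset.ne_of_mem_erase hR)
        exact ((hstep R hRT.1 (ih R hss hRT.1) T).resolve_right hT.ne_empty).symm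
      · simp [Considered, hRT, hμ0 hT hRT]
  by_cases hTS : IsLowerSegment r T S
  · exact (hstep T hTS.1 (hdiag T hTS.1) S).resolve_right hS.ne_empty
  · simp [Considered, hTS, hμ0 hS hTS]

/-- Theorem 6, Random Attention Filter: Every attention rule
that is monotonic and triangular with respect to a preference `≻` is a convex
combination of attention filters that are triangular with respect to `≻`. -/
theorem stmt10 (r : α → α → Prop) (hr : IsPref r)
    (μ : Finset α → Finset α → ℝ) (hμ : IsAttentionRule μ)
    (hmono : MonotonicAttention μ) (htri : Triangular r μ) :
    ∃ ψ : (Finset α → Finset α) → ℝ,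
      (∀ Γ, 0 ≤ ψ Γ) ∧
      (∀ Γ, ψ Γ ≠ 0 → IsAttentionFilter Γ ∧ TriangularFilter r Γ) ∧
      (∑ Γ : Finset α → Finset α, ψ Γ) = 1 ∧
      ∀ S T : Finset α, S.Nonempty → T ⊆ S → T.Nonempty →
        μ S T = ∑ Γ : Finset α → Finset α, if Γ S = T then ψ Γ else 0 := by
  obtain ⟨w, hw0, hw1, hw, hwμ⟩ := exists_retention_weights (r := r) hμ hmono
  have hpers : ∀ D : Finset α → Finset (Finset α), ∏ R, w R (D R) ≠ 0 → Persistent r D :=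
    fun D hD => hw D fun T => Finset.prod_ne_zero_iff.1 hD T (Finset.mem_univ T)
  refine ⟨fun Γ => ∑ D : Finset α → Finset (Finset α),
    if inducedFilter r D = Γ then ∏ R, w R (D R) else 0, fun Γ => ?_, fun Γ hΓ => ?_, ?_, ?_⟩
  · refine Finset.sum_nonneg fun D _ => ?_
    split_ifs
    · exact Finset.prod_nonneg fun R _ => hw0 R _
    · exact le_rfl
  · obtain ⟨D, -, hD⟩ := Finset.exists_ne_zero_of_sum_ne_zero hΓ
    obtain ⟨h, hW⟩ := ite_ne_right_iff.1 hD
    subst h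
    exact ⟨(hpers D hW).isAttentionFilter hr.asymm, fun S hS =>
      (isLowerSegment_iff hr).1 (considered_inducedFilter r D hS).1⟩
  · rw [Finset.sum_comm]
    simp only [Finset.sum_ite_eq, Finset.mem_univ, if_true]
    rw [← Fintype.prod_sum]
    simp [hw1]
  · intro S T hS _ _
    rw [← sum_considered_eq hr hμ htri w hw1 hw hwμ hS T]
    simp only [← Finset.sum_filter (fun Γ : Finset α → Finset α => Γ S = T)]
    rw [Finset.sum_comm]
    refine Finset.sum_congr rfl fun D _ => ?_
    by_cases hD : ∏ R, w R (D R) = 0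
    · simp [hD]
    · simp [← (hpers D hD).inducedFilter_eq_iff hr.asymm hS]
end

section
/- (Remark 2, Triangular Random Attention Filter Representation) If the choice rule π has a RAM representation (≻, μ), then there exist finitely many attention filters Γ_1, …, Γ_J, each triangular with respect to ≻, and nonnegative weights ψ_1, …, ψ_J summing to 1, such that the attention rule μ′(T|S) = Σ_j 1(Γ_j(S) = T)·ψ_j satisfies: (≻, μ′) is a RAM representation of π. -/
open Finset
open scoped Classical

variable {α : Type*} [Fintype α] [DecidableEq α]

open Filter Topology

set_option linter.unusedSectionVars false

/-- The polytope of choice rules in which removing an alternative never lowers the choice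
probability of an `r`-worse alternative. Values outside the choice problem are set to `0`. -/
def monotoneChoice (r : α → α → Prop) : Set (Finset α → α → ℝ) :=
  {x | (∀ S b, 0 ≤ x S b) ∧ (∀ S b, b ∉ S → x S b = 0) ∧
    (∀ S : Finset α, S.Nonempty → ∑ b ∈ S, x S b = 1) ∧
    ∀ S a b, a ∈ S → b ∈ S → r a b → x S b ≤ x (S.erase a) b}

/-- A choice function that is unaffected by removing an alternative `r`-better than the chosen
one. -/
def IsMonotoneSelection (r : α → α → Prop) (c : Finset α → α) : Prop :=
  (∀ S : Finset α, S.Nonempty → c S ∈ S) ∧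
    ∀ S a, a ∈ S → c S ∈ S → r a (c S) → c (S.erase a) = c S

/-- The degenerate choice rule of a choice function. -/
noncomputable def selectionRule (c : Finset α → α) (S : Finset α) (b : α) : ℝ :=
  if b ∈ S ∧ c S = b then 1 else 0

lemma IsPref.ne {r : α → α → Prop} (hr : IsPref r) {a b : α} (h : r a b) : a ≠ b := by
  rintro rfl
  exact hr.asymm _ _ h h

lemma IsPref.isBest_unique {r : α → α → Prop} (hr : IsPref r) {S : Finset α} {a b : α}
    (ha : IsBest r a S) (hb : IsBest r b S) : a = b := by
  by_contra hab
  exact hr.asymm _ _ (ha.2 b hb.1 (Ne.symm hab)) (hb.2 a ha.1 hab)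

lemma IsPref.exists_isBest {r : α → α → Prop} (hr : IsPref r) {S : Finset α}
    (hS : S.Nonempty) : ∃ a, IsBest r a S := by
  induction hS using Finset.Nonempty.cons_induction with
  | singleton a => exact ⟨a, by simp [IsBest]⟩
  | cons a s has hs ih =>
    obtain ⟨b, hb, hbest⟩ := ih
    have hne : a ≠ b := fun h => has (h ▸ hb)
    rcases hr.total a b hne with h | h
    · refine ⟨a, by simp, fun d hd hda => ?_⟩
      rcases Finset.mem_cons.1 hd with rfl | hd
      · exact absurd rfl hda
      · by_cases hdb : d = b
        · exact hdb ▸ h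
        · exact hr.trans _ _ _ h (hbest d hd hdb)
    · refine ⟨b, by simp [hb], fun d hd hdb => ?_⟩
      rcases Finset.mem_cons.1 hd with rfl | hd
      · exact h
      · exact hbest d hd hdb

lemma IsBest.erase {r : α → α → Prop} {S : Finset α} {a b : α} (h : IsBest r a S)
    (hab : a ≠ b) : IsBest r a (S.erase b) :=
  ⟨Finset.mem_erase.2 ⟨hab, h.1⟩, fun d hd => h.2 d (Finset.mem_of_mem_erase hd)⟩

/-- Keep the alternative selected after removing the best one as long as it satisfies `p`;
otherwise select the best one. -/
noncomputable def greedySelection [Nonempty α] (r : α → α → Prop) (p : Finset α → α → Prop)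
    (S : Finset α) : α :=
  if h : ∃ a, IsBest r a S then
    if greedySelection r p (S.erase h.choose) ∈ S.erase h.choose ∧
        p S (greedySelection r p (S.erase h.choose))
    then greedySelection r p (S.erase h.choose) else h.choose
  else Classical.arbitrary α
termination_by S.card
decreasing_by all_goals exact Finset.card_erase_lt_of_mem h.choose_spec.1

section greedySelection

variable [Nonempty α] {r : α → α → Prop} {p : Finset α → α → Prop}

lemma greedySelection_eq (hr : IsPref r) {S : Finset α} {a : α} (ha : IsBest r a S) :
    greedySelection r p S =
      if greedySelection r p (S.erase a) ∈ S.erase a ∧ p S (greedySelection r p (S.erase a))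
      then greedySelection r p (S.erase a) else a := by
  have h : ∃ a, IsBest r a S := ⟨a, ha⟩
  have hc : h.choose = a := hr.isBest_unique h.choose_spec ha
  rw [greedySelection, dif_pos h, hc]

lemma greedySelection_mem (hr : IsPref r) {S : Finset α} (hS : S.Nonempty) :
    greedySelection r p S ∈ S := by
  obtain ⟨a, ha⟩ := hr.exists_isBest hS
  rw [greedySelection_eq hr ha]
  split_ifs with h
  · exact Finset.mem_of_mem_erase h.1
  · exact ha.1

lemma greedySelection_of_erase_best (hr : IsPref r) {S : Finset α} {a b : α}
    (ha : IsBest r a S) (hb : b ∈ S.erase a) (hp : p S b)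
    (h : greedySelection r p (S.erase a) = b) : greedySelection r p S = b := by
  rw [greedySelection_eq hr ha, h, if_pos ⟨hb, hp⟩]

lemma greedySelection_erase_best (hr : IsPref r) {S : Finset α} {a b : α}
    (ha : IsBest r a S) (hab : a ≠ b) (h : greedySelection r p S = b) :
    greedySelection r p (S.erase a) = b ∧ p S b := by
  rw [greedySelection_eq hr ha] at h
  split_ifs at h with h'
  · exact ⟨h, h ▸ h'.2⟩
  · exact absurd h hab

lemma greedySelection_erase
    (hp : ∀ S a b, a ∈ S → b ∈ S → r a b → p S b → p (S.erase a) b)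
    (hr : IsPref r) {S : Finset α} {a b : α} (ha : a ∈ S) (hb : b ∈ S)
    (hab : r a b) (h : greedySelection r p S = b) : greedySelection r p (S.erase a) = b := by
  induction S using Finset.strongInduction with
  | H S ih =>
    obtain ⟨t, ht⟩ := hr.exists_isBest ⟨a, ha⟩
    have htb : t ≠ b := by
      rintro rfl
      exact hr.asymm _ _ hab (ht.2 a ha (hr.ne hab))
    obtain ⟨hS, hpS⟩ := greedySelection_erase_best hr ht htb h
    by_cases hta : t = a
    · exact hta ▸ hS
    · have hbt : b ∈ S.erase t := Finset.mem_erase.2 ⟨htb.symm, hb⟩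
      have hlow := ih _ (Finset.erase_ssubset ht.1) (Finset.mem_erase.2 ⟨Ne.symm hta, ha⟩) hbt hS
      rw [Finset.erase_right_comm] at hlow
      refine greedySelection_of_erase_best hr (ht.erase hta) ?_ (hp _ _ _ ha hb hab hpS) hlow
      exact Finset.mem_erase.2 ⟨htb.symm, Finset.mem_erase.2 ⟨(hr.ne hab).symm, hb⟩⟩

lemma greedySelection_of_erase
    (hp : ∀ S a b, a ∈ S → b ∈ S → r a b → p S b → p (S.erase a) b)
    (hr : IsPref r) {S : Finset α} {a b : α} (ha : a ∈ S)
    (hb : b ∈ S) (hab : r a b) (hpS : p S b) (h : greedySelection r p (S.erase a) = b) :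
    greedySelection r p S = b := by
  induction S using Finset.strongInduction with
  | H S ih =>
    obtain ⟨t, ht⟩ := hr.exists_isBest ⟨a, ha⟩
    have htb : t ≠ b := by
      rintro rfl
      exact hr.asymm _ _ hab (ht.2 a ha (hr.ne hab))
    have hbt : b ∈ S.erase t := Finset.mem_erase.2 ⟨htb.symm, hb⟩
    refine greedySelection_of_erase_best hr ht hbt hpS ?_
    by_cases hta : t = a
    · exact hta ▸ h
    · have hlow := (greedySelection_erase_best hr (ht.erase hta) htb h).1
      rw [Finset.erase_right_comm] at hlow
      exact ih _ (Finset.erase_ssubset ht.1) (Finset.mem_erase.2 ⟨Ne.symm hta, ha⟩) hbt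
        (hp _ _ _ ht.1 hb (ht.2 b hb htb.symm) hpS) hlow

lemma isMonotoneSelection_greedySelection
    (hp : ∀ S a b, a ∈ S → b ∈ S → r a b → p S b → p (S.erase a) b)
    (hr : IsPref r) :
    IsMonotoneSelection r (greedySelection r p) :=
  ⟨fun _ hS => greedySelection_mem hr hS,
    fun _ _ ha hc hac => greedySelection_erase hp hr ha hc hac rfl⟩

end greedySelection

lemma monotoneChoice_pos_erase {r : α → α → Prop} {x : Finset α → α → ℝ}
    (hx : x ∈ monotoneChoice r) (S : Finset α) (a b : α) (ha : a ∈ S) (hb : b ∈ S)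
    (hab : r a b) (h : 0 < x S b) : 0 < x (S.erase a) b :=
  h.trans_le (hx.2.2.2 S a b ha hb hab)

lemma greedySelection_pos [Nonempty α] {r : α → α → Prop} (hr : IsPref r)
    {x : Finset α → α → ℝ} (hx : x ∈ monotoneChoice r) {S : Finset α} (hS : S.Nonempty) :
    0 < x S (greedySelection r (fun S b => 0 < x S b) S) := by
  induction S using Finset.strongInduction with
  | H S ih =>
    obtain ⟨t, ht⟩ := hr.exists_isBest hS
    rw [greedySelection_eq hr ht]
    split_ifs with h
    · exact h.2
    by_contra hneg
    have h0 : x S t = 0 := le_antisymm (not_lt.1 hneg) (hx.1 S t)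
    have hsum : ∑ b ∈ S.erase t, x S b = 1 := by
      rw [← hx.2.2.1 S hS, ← Finset.add_sum_erase _ _ ht.1, h0, zero_add]
    have hne : (S.erase t).Nonempty := by
      by_contra he
      simp [Finset.not_nonempty_iff_eq_empty.1 he] at hsum
    have hle : ∀ b ∈ S.erase t, x S b ≤ x (S.erase t) b := fun b hb =>
      hx.2.2.2 S t b ht.1 (Finset.mem_of_mem_erase hb)
        (ht.2 b (Finset.mem_of_mem_erase hb) (Finset.ne_of_mem_erase hb))
    have heq := (Finset.sum_eq_sum_iff_of_le hle).1 (hsum.trans (hx.2.2.1 _ hne).symm)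
    have hmem := greedySelection_mem (p := fun S b => 0 < x S b) hr hne
    exact h ⟨hmem, (heq _ hmem).symm ▸ ih _ (Finset.erase_ssubset ht.1) hne⟩

lemma selectionRule_mem_monotoneChoice {r : α → α → Prop} (hr : IsPref r) {c : Finset α → α}
    (hc : IsMonotoneSelection r c) : selectionRule c ∈ monotoneChoice r := by
  refine ⟨fun S b => ?_, fun S b hb => ?_, fun S hS => ?_, fun S a b ha hb hab => ?_⟩
  · unfold selectionRule
    split_ifs <;> norm_num
  · simp [selectionRule, hb]
  · rw [Finset.sum_eq_single_of_mem (c S) (hc.1 S hS)]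
    · simp [selectionRule, hc.1 S hS]
    · intro b _ hb
      simp [selectionRule, Ne.symm hb]
  · by_cases h : c S = b
    · subst h
      simp [selectionRule, hc.2 S a ha hb hab, hb, (hr.ne hab).symm]
    · simp only [selectionRule, h, and_false, if_false]
      split_ifs <;> norm_num

lemma convex_monotoneChoice (r : α → α → Prop) : Convex ℝ (monotoneChoice r) := by
  intro x hx y hy s t hs ht hst
  refine ⟨fun S b => ?_, fun S b hb => ?_, fun S hS => ?_, fun S a b ha hb hab => ?_⟩
  · have := hx.1 S b
    have := hy.1 S b
    simp only [Pi.add_apply, Pi.smul_apply, smul_eq_mul]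
    positivity
  · simp [hx.2.1 S b hb, hy.2.1 S b hb]
  · simp [Finset.sum_add_distrib, ← Finset.mul_sum, hx.2.2.1 S hS, hy.2.2.1 S hS, hst]
  · have := hx.2.2.2 S a b ha hb hab
    have := hy.2.2.2 S a b ha hb hab
    simp only [Pi.add_apply, Pi.smul_apply, smul_eq_mul]
    gcongr

lemma isCompact_monotoneChoice (r : α → α → Prop) : IsCompact (monotoneChoice r) := by
  refine IsCompact.of_isClosed_subset (isCompact_Icc (a := 0) (b := 1)) ?_ ?_
  · simp only [monotoneChoice, Set.ofPred_and, Set.ofPred_forall]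
    refine .inter ?_ (.inter ?_ (.inter ?_ ?_)) <;>
      repeat' refine isClosed_iInter fun _ => ?_
    · exact isClosed_le (by fun_prop) (by fun_prop)
    · exact isClosed_eq (by fun_prop) (by fun_prop)
    · exact isClosed_eq (by fun_prop) (by fun_prop)
    · exact isClosed_le (by fun_prop) (by fun_prop)
  · intro x hx
    refine ⟨fun S b => hx.1 S b, fun S b => ?_⟩
    by_cases hb : b ∈ S
    · calc x S b ≤ ∑ b ∈ S, x S b := Finset.single_le_sum (fun b _ => hx.1 S b) hb
        _ = 1 := hx.2.2.1 S ⟨b, hb⟩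
    · simp [hx.2.1 S b hb]

lemma eventually_nonneg_add_mul_sub {s t : ℝ} (hs : 0 ≤ s) (h : s = 0 → t = 0) :
    ∀ᶠ ε : ℝ in 𝓝[>] 0, 0 ≤ s + ε * (s - t) := by
  rcases hs.eq_or_lt with hs | hs
  · simp [← hs, h hs.symm]
  · have hlim : Tendsto (fun ε : ℝ => s + ε * (s - t)) (𝓝[>] 0) (𝓝 (s + 0 * (s - t))) :=
      Continuous.tendsto (by fun_prop) 0 |>.mono_left nhdsWithin_le_nhds
    filter_upwards [hlim.eventually (lt_mem_nhds (a := 0) (by simpa using hs))] with ε hε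
    exact hε.le

lemma exists_selectionRule_of_mem_extremePoints [Nonempty α] {r : α → α → Prop} (hr : IsPref r)
    {x : Finset α → α → ℝ} (hx : x ∈ (monotoneChoice r).extremePoints ℝ) :
    ∃ c, IsMonotoneSelection r c ∧ selectionRule c = x := by
  obtain ⟨hxC, hext⟩ := hx
  have hpos := monotoneChoice_pos_erase hxC
  set c := greedySelection r (fun S b => 0 < x S b) with hcdef
  have hc : IsMonotoneSelection r c := isMonotoneSelection_greedySelection hpos hr
  have hd := selectionRule_mem_monotoneChoice hr hc
  refine ⟨c, hc, ?_⟩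
  have hzero : ∀ S b, x S b = 0 → selectionRule c S b = 0 := by
    intro S b h0
    refine if_neg ?_
    rintro ⟨hb, rfl⟩
    exact (greedySelection_pos hr hxC ⟨_, hb⟩).ne' h0
  have htight : ∀ S a b, a ∈ S → b ∈ S → r a b → x (S.erase a) b - x S b = 0 →
      selectionRule c (S.erase a) b - selectionRule c S b = 0 := by
    intro S a b ha hb hab h0
    have hb' : b ∈ S.erase a := Finset.mem_erase.2 ⟨(hr.ne hab).symm, hb⟩
    have hiff : c (S.erase a) = b ↔ c S = b := by
      constructor
      · intro h
        refine greedySelection_of_erase hpos hr ha hb hab ?_ h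
        have := greedySelection_pos hr hxC ⟨b, hb'⟩
        rw [← hcdef, h] at this
        linarith
      · exact greedySelection_erase hpos hr ha hb hab
    simp [selectionRule, hb, hb', hiff]
  have hev : ∀ᶠ ε : ℝ in 𝓝[>] 0, x + ε • (x - selectionRule c) ∈ monotoneChoice r := by
    have h1 : ∀ᶠ ε : ℝ in 𝓝[>] 0, ∀ S b, 0 ≤ x S b + ε * (x S b - selectionRule c S b) := by
      simp only [Filter.eventually_all]
      exact fun S b => eventually_nonneg_add_mul_sub (hxC.1 S b) (hzero S b)
    have h2 : ∀ᶠ ε : ℝ in 𝓝[>] 0, ∀ S a b, a ∈ S → b ∈ S → r a b →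
        0 ≤ (x (S.erase a) b - x S b) + ε * ((x (S.erase a) b - x S b) -
          (selectionRule c (S.erase a) b - selectionRule c S b)) := by
      simp only [Filter.eventually_all]
      exact fun S a b ha hb hab => eventually_nonneg_add_mul_sub
        (sub_nonneg.2 (hxC.2.2.2 S a b ha hb hab)) (htight S a b ha hb hab)
    filter_upwards [h1, h2] with ε h1 h2
    refine ⟨h1, fun S b hb => ?_, fun S hS => ?_, fun S a b ha hb hab => ?_⟩
    · simp [hxC.2.1 S b hb, hd.2.1 S b hb]
    · simp [Finset.sum_add_distrib, ← Finset.mul_sum, hxC.2.2.1 S hS, hd.2.2.1 S hS]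
    · have := h2 S a b ha hb hab
      simp only [Pi.add_apply, Pi.smul_apply, Pi.sub_apply, smul_eq_mul]
      linarith
  obtain ⟨ε, hε, hεpos⟩ := (hev.and self_mem_nhdsWithin).exists
  have hεpos : 0 < ε := hεpos
  refine hext hd hε ⟨ε / (1 + ε), 1 / (1 + ε), by positivity, by positivity, by field_simp; ring, ?_⟩
  ext S b
  simp only [Pi.add_apply, Pi.smul_apply, Pi.sub_apply, smul_eq_mul]
  field_simp
  ring

/-- Every monotone choice rule is a mixture of monotone selections. -/
lemma monotoneChoice_subset_convexHull [Nonempty α] {r : α → α → Prop} (hr : IsPref r) :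
    monotoneChoice r ⊆ convexHull ℝ (Set.image selectionRule {c | IsMonotoneSelection r c}) := by
  rw [← closure_convexHull_extremePoints (isCompact_monotoneChoice r) (convex_monotoneChoice r)]
  refine closure_minimal (convexHull_mono fun x hx => ?_) (Set.Finite.isClosed_convexHull ℝ ?_)
  · exact exists_selectionRule_of_mem_extremePoints hr hx
  · exact (Set.toFinite _).image _

lemma IsRAM.le_erase {π : Finset α → α → ℝ} {r : α → α → Prop} {μ : Finset α → Finset α → ℝ}
    (h : IsRAM π r μ) {S : Finset α} {a b : α} (ha : a ∈ S) (hb : b ∈ S) (hab : r a b) :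
    π S b ≤ π (S.erase a) b := by
  obtain ⟨⟨-, hr, hμ, hrep⟩, hmon⟩ := h
  have hb' : b ∈ S.erase a := Finset.mem_erase.2 ⟨(hr.ne hab).symm, hb⟩
  have hnot : ∀ T, IsBest r b T → a ∉ T := fun T hT haT =>
    hr.asymm _ _ hab (hT.2 a haT (hr.ne hab))
  rw [hrep S ⟨b, hb⟩ b hb, hrep _ ⟨b, hb'⟩ b hb',
    ← Finset.sum_subset (Finset.powerset_mono.2 (Finset.erase_subset a S))]
  · refine Finset.sum_le_sum fun T hT => ?_
    split_ifs with hbT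
    · exact hmon S T ⟨b, hb⟩ ((Finset.mem_powerset.1 hT).trans (Finset.erase_subset a S))
        ⟨b, hbT.1⟩ a ha (hnot T hbT)
    · exact le_rfl
  · intro T hT hT'
    refine if_neg fun hbT => hT' ?_
    exact Finset.mem_powerset.2 (Finset.subset_erase.2 ⟨Finset.mem_powerset.1 hT, hnot T hbT⟩)

lemma IsRAM.mem_monotoneChoice {π : Finset α → α → ℝ} {r : α → α → Prop}
    {μ : Finset α → Finset α → ℝ} (h : IsRAM π r μ) :
    (fun S b => if b ∈ S then π S b else 0) ∈ monotoneChoice r := by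
  have hπ := h.1.1
  refine ⟨fun S b => ?_, fun S b hb => ?_, fun S hS => ?_, fun S a b ha hb hab => ?_⟩
  · dsimp only
    split_ifs with hb
    · exact (hπ S ⟨b, hb⟩).1 b hb
    · exact le_rfl
  · simp [hb]
  · rw [← (hπ S hS).2.2]
    exact Finset.sum_congr rfl fun b hb => if_pos hb
  · simpa [hb, (h.1.2.1.ne hab).symm] using h.le_erase ha hb hab

lemma isBest_lowerContour_inter {r : α → α → Prop} {S : Finset α} {a : α} (ha : a ∈ S) :
    IsBest r a (lowerContour r a ∩ S) := by
  refine ⟨by simp [lowerContour, ha], fun b hb hba => ?_⟩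
  have : b = a ∨ r a b := by simpa [lowerContour] using (Finset.mem_inter.1 hb).1
  exact this.resolve_left hba

namespace IsMonotoneSelection

variable {r : α → α → Prop} {c : Finset α → α}

lemma isAttentionFilter (hr : IsPref r) (hc : IsMonotoneSelection r c) :
    IsAttentionFilter fun S => lowerContour r (c S) ∩ S := by
  intro S hS
  have hbest := isBest_lowerContour_inter (r := r) (hc.1 S hS)
  refine ⟨Finset.inter_subset_right, ⟨_, hbest.1⟩, fun a ha haΓ _ => ?_⟩
  have hac : ¬(a = c S ∨ r (c S) a) := by simpa [lowerContour, ha] using haΓ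
  push Not at hac
  have hra : r a (c S) := (hr.total a (c S) hac.1).resolve_right hac.2
  dsimp only
  rw [hc.2 S a ha (hc.1 S hS) hra, Finset.inter_erase, Finset.erase_eq_of_notMem haΓ]

lemma triangularFilter (hc : IsMonotoneSelection r c) :
    TriangularFilter r fun S => lowerContour r (c S) ∩ S :=
  fun S hS => ⟨c S, hc.1 S hS, rfl⟩

end IsMonotoneSelection

section RandomFilter

variable {ι : Type*} [Fintype ι] {Γ : ι → Finset α → Finset α} {ψ : ι → ℝ}

lemma sum_powerset_randomFilter {S : Finset α} (hΓ : ∀ j, Γ j S ⊆ S) (q : Finset α → Prop) :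
    (∑ T ∈ S.powerset, if q T then ∑ j, (if Γ j S = T then ψ j else 0) else 0) =
      ∑ j, if q (Γ j S) then ψ j else 0 := by
  simp_rw [← Finset.sum_filter q]
  rw [Finset.sum_comm]
  refine Finset.sum_congr rfl fun j _ => ?_
  simp [Finset.sum_ite_eq, hΓ j]

lemma isAttentionRule_randomFilter (hΓ : ∀ j, IsAttentionFilter (Γ j)) (hψ : ∀ j, 0 ≤ ψ j)
    (hsum : ∑ j, ψ j = 1) :
    IsAttentionRule fun S T => ∑ j, if Γ j S = T then ψ j else 0 := by
  refine fun S hS => ⟨fun T _ _ => ?_, fun T hT => ?_, ?_⟩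
  · exact Finset.sum_nonneg fun j _ => by split_ifs <;> simp [hψ j]
  · refine Finset.sum_eq_zero fun j _ => if_neg ?_
    rintro rfl
    exact hT ⟨(hΓ j S hS).1, (hΓ j S hS).2.1⟩
  · simpa [hsum] using
      sum_powerset_randomFilter (ψ := ψ) (fun j => (hΓ j S hS).1) (fun _ => True)

lemma monotonicAttention_randomFilter (hΓ : ∀ j, IsAttentionFilter (Γ j)) (hψ : ∀ j, 0 ≤ ψ j) :
    MonotonicAttention fun S T => ∑ j, if Γ j S = T then ψ j else 0 := by
  intro S T hS hTS hT a ha haT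
  refine Finset.sum_le_sum fun j _ => ?_
  by_cases h : Γ j S = T
  · subst h
    have hne : (S.erase a).Nonempty := hT.mono (Finset.subset_erase.2 ⟨hTS, haT⟩)
    simp [(hΓ j S hS).2.2 a ha haT hne]
  · rw [if_neg h]
    split_ifs <;> simp [hψ j]

end RandomFilter

/-- Remark 2: If `π` has a RAM representation `(≻, μ)`, then
there exist finitely many attention filters `Γ_1, …, Γ_J`, each triangular
with respect to `≻`, and nonnegative weights `ψ_1, …, ψ_J` summing to 1, such
that `(≻, μ')` with `μ'(T|S) = Σ_j 1(Γ_j(S) = T) ψ_j` is a RAM representation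
of `π`. -/
theorem stmt11 (π : Finset α → α → ℝ) (r : α → α → Prop)
    (μ : Finset α → Finset α → ℝ) (h : IsRAM π r μ) :
    ∃ (J : ℕ) (Γ : Fin J → Finset α → Finset α) (ψ : Fin J → ℝ),
      (∀ j, IsAttentionFilter (Γ j) ∧ TriangularFilter r (Γ j)) ∧
      (∀ j, 0 ≤ ψ j) ∧ (∑ j, ψ j) = 1 ∧
      IsRAM π r (fun S T => ∑ j, if Γ j S = T then ψ j else 0) := by
  have hr := h.1.2.1
  rcases isEmpty_or_nonempty α with hα | hα
  · have hS : ∀ S : Finset α, ¬S.Nonempty := fun S ⟨a, _⟩ => hα.elim a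
    exact ⟨1, fun _ S => S, fun _ => 1, fun _ => ⟨fun S h => (hS S h).elim, fun S h => (hS S h).elim⟩,
      by simp, by simp, ⟨h.1.1, hr, fun S h => (hS S h).elim, fun S h => (hS S h).elim⟩,
      fun S _ h => (hS S h).elim⟩
  obtain ⟨ι, _, w, z, hw, hw1, hz, hzπ⟩ :=
    mem_convexHull_iff_exists_fintype.1 (monotoneChoice_subset_convexHull hr h.mem_monotoneChoice)
  choose c hc hcz using hz
  replace hc : ∀ i, IsMonotoneSelection r (c i) := hc
  let e := (Fintype.equivFin ι).symm
  have hψ : ∀ j, 0 ≤ w (e j) := fun j => hw _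
  have hsum : ∑ j, w (e j) = 1 := by rw [e.sum_comp, hw1]
  have hΓ : ∀ j, IsAttentionFilter fun S => lowerContour r (c (e j) S) ∩ S :=
    fun j => (hc (e j)).isAttentionFilter hr
  refine ⟨Fintype.card ι, fun j S => lowerContour r (c (e j) S) ∩ S, fun j => w (e j),
    fun j => ⟨hΓ j, (hc (e j)).triangularFilter⟩, hψ, hsum,
    ⟨h.1.1, hr, isAttentionRule_randomFilter hΓ hψ hsum, fun S hS a ha => ?_⟩,
    monotonicAttention_randomFilter hΓ hψ⟩
  have hval := congrFun (congrFun hzπ S) a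
  simp only [ha, if_true, Finset.sum_apply, Pi.smul_apply, smul_eq_mul] at hval
  rw [sum_powerset_randomFilter (fun j => (hΓ j S hS).1), ← hval, ← e.sum_comp]
  refine Finset.sum_congr rfl fun j _ => ?_
  have hbest := isBest_lowerContour_inter (r := r) ((hc (e j)).1 S hS)
  have hiff : IsBest r a (lowerContour r (c (e j) S) ∩ S) ↔ c (e j) S = a :=
    ⟨hr.isBest_unique hbest, fun h => h ▸ hbest⟩
  simp [← hcz, selectionRule, ha, hiff]
end

section
/- (Lemma A.1) Fix a preference ≻ on X and let μ be an attention rule that is monotonic and triangular with respect to ≻ and is not deterministic. Let 𝒳_μ be the collection of choice problems S for which μ(T|S) = 1 holds for no T ⊆ S, and let k_μ = min_{S ∈ 𝒳_μ} |S|. Then for any S ∈ 𝒳_μ with |S| = k_μ: there are at most two nonempty subsets T ⊆ S with 0 < μ(T|S) < 1, and moreover 0 < μ(S|S) < 1. -/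
open Finset
open scoped Classical

variable {α : Type*} [Fintype α] [DecidableEq α]

theorem IsAttentionRule.nonneg {β : Type*} [DecidableEq β]
    {μ : Finset β → Finset β → ℝ} (hμ : IsAttentionRule μ)
    {S : Finset β} (hS : S.Nonempty) (T : Finset β) : 0 ≤ μ S T := by
  by_cases h : T ⊆ S ∧ T.Nonempty
  · exact (hμ S hS).1 T h.1 h.2
  · exact ((hμ S hS).2.1 T h).ge

theorem IsAttentionRule.subset_and_nonempty_of_pos {β : Type*} [DecidableEq β]
    {μ : Finset β → Finset β → ℝ}
    (hμ : IsAttentionRule μ) {S T : Finset β} (hS : S.Nonempty) (h : 0 < μ S T) :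
    T ⊆ S ∧ T.Nonempty := by
  by_contra h'
  exact h.ne' ((hμ S hS).2.1 T h')

theorem IsAttentionRule.le_one {β : Type*} [DecidableEq β]
    {μ : Finset β → Finset β → ℝ} (hμ : IsAttentionRule μ)
    {S T : Finset β} (hS : S.Nonempty) (hT : T ⊆ S) : μ S T ≤ 1 := by
  rw [← (hμ S hS).2.2]
  exact Finset.single_le_sum (fun U _ => hμ.nonneg hS U) (Finset.mem_powerset.2 hT)

theorem IsAttentionRule.eq_of_pos_of_eq_one {β : Type*} [DecidableEq β]
    {μ : Finset β → Finset β → ℝ}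
    (hμ : IsAttentionRule μ) {S T U : Finset β} (hS : S.Nonempty) (hT : 0 < μ S T)
    (hU : μ S U = 1) : T = U := by
  by_contra hne
  have hTS := (hμ.subset_and_nonempty_of_pos hS hT).1
  have hUS := (hμ.subset_and_nonempty_of_pos hS (hU ▸ one_pos)).1
  have hle : ∑ V ∈ {T, U}, μ S V ≤ ∑ V ∈ S.powerset, μ S V := by
    refine Finset.sum_le_sum_of_subset_of_nonneg ?_ fun V _ _ => hμ.nonneg hS V
    intro V hV
    simp only [Finset.mem_insert, Finset.mem_singleton] at hV
    rcases hV with rfl | rfl <;> simpa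
  rw [(hμ S hS).2.2, Finset.sum_pair hne] at hle
  linarith

theorem IsAttentionRule.eq_one_of_forall_pos_eq {β : Type*} [DecidableEq β]
    {μ : Finset β → Finset β → ℝ}
    (hμ : IsAttentionRule μ) {S : Finset β} (hS : S.Nonempty)
    (h : ∀ T U, 0 < μ S T → 0 < μ S U → T = U) : ∃ T ⊆ S, μ S T = 1 := by
  obtain ⟨T, hTS, hT⟩ : ∃ T ∈ S.powerset, 0 < μ S T :=
    Finset.exists_lt_of_sum_lt (by simp [(hμ S hS).2.2])
  refine ⟨T, Finset.mem_powerset.1 hTS, ?_⟩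
  rw [← (hμ S hS).2.2]
  refine (Finset.sum_eq_single_of_mem T hTS fun U _ hUT => ?_).symm
  by_contra hU
  exact hUT (h U T ((hμ.nonneg hS U).lt_of_ne' hU) hT)

theorem lowerContour_subset_of_rel {r : α → α → Prop} (hr : IsPref r) {a b : α}
    (h : r a b) : lowerContour r b ⊆ lowerContour r a := by
  intro c hc
  simp only [lowerContour, Finset.mem_filter, Finset.mem_univ, true_and] at hc ⊢
  rcases hc with rfl | hc
  · exact Or.inr h
  · exact Or.inr (hr.trans _ _ _ h hc)

theorem Triangular.subset_or_subset {r : α → α → Prop} (hr : IsPref r)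
    {μ : Finset α → Finset α → ℝ} (htri : Triangular r μ) {S T U : Finset α}
    (hS : S.Nonempty) (hT : 0 < μ S T) (hU : 0 < μ S U) : T ⊆ U ∨ U ⊆ T := by
  obtain ⟨a, -, rfl⟩ := htri S T hS hT
  obtain ⟨b, -, rfl⟩ := htri S U hS hU
  by_cases hab : a = b
  · exact Or.inl (by rw [hab])
  · exact (hr.total a b hab).symm.imp
      (fun h => Finset.inter_subset_inter_right (lowerContour_subset_of_rel hr h))
      (fun h => Finset.inter_subset_inter_right (lowerContour_subset_of_rel hr h))

/-- Lemma A.1: Let `μ` be a non-deterministic attention rule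
that is monotonic and triangular with respect to `≻`. If `S` is a choice
problem of minimal cardinality among those with `μ(T|S) = 1` for no `T ⊆ S`,
then at most two nonempty subsets `T ⊆ S` satisfy `0 < μ(T|S) < 1`, and
moreover `0 < μ(S|S) < 1`. -/
theorem stmt12 (r : α → α → Prop) (hr : IsPref r)
    (μ : Finset α → Finset α → ℝ) (hμ : IsAttentionRule μ)
    (hmono : MonotonicAttention μ) (htri : Triangular r μ)
    (hnd : ¬ Deterministic μ)
    (S : Finset α) (hS : S.Nonempty) (hSX : ∀ T ⊆ S, μ S T ≠ 1)
    (hmin : ∀ S' : Finset α, S'.Nonempty → (∀ T ⊆ S', μ S' T ≠ 1) →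
      S.card ≤ S'.card) :
    (S.powerset.filter fun T => T.Nonempty ∧ 0 < μ S T ∧ μ S T < 1).card ≤ 2 ∧
      (0 < μ S S ∧ μ S S < 1) := by
  have key : ∀ T U, 0 < μ S T → 0 < μ S U → T ⊆ U → U ≠ S → T = U := by
    intro T U hT hU hTU hUS
    obtain ⟨hUS', hUne⟩ := hμ.subset_and_nonempty_of_pos hS hU
    obtain ⟨hTS', hTne⟩ := hμ.subset_and_nonempty_of_pos hS hT
    obtain ⟨b, hbS, hbU⟩ := Finset.exists_of_ssubset (hUS'.ssubset_of_ne hUS)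
    have hne : (S.erase b).Nonempty := hUne.mono (Finset.subset_erase.2 ⟨hUS', hbU⟩)
    obtain ⟨V, -, hV⟩ : ∃ V ⊆ S.erase b, μ (S.erase b) V = 1 := by
      by_contra! h
      exact (Finset.card_erase_lt_of_mem hbS).not_ge (hmin _ hne h)
    have hT' := hT.trans_le (hmono S T hS hTS' hTne b hbS fun h => hbU (hTU h))
    have hU' := hU.trans_le (hmono S U hS hUS' hUne b hbS hbU)
    exact (hμ.eq_of_pos_of_eq_one hne hT' hV).trans (hμ.eq_of_pos_of_eq_one hne hU' hV).symm
  have huniq : ∀ T U, 0 < μ S T → 0 < μ S U → T ≠ S → U ≠ S → T = U := by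
    intro T U hT hU hTS hUS
    rcases htri.subset_or_subset hr hS hT hU with h | h
    · exact key T U hT hU h hUS
    · exact (key U T hU hT h hTS).symm
  have hpos : 0 < μ S S := by
    by_contra h
    obtain ⟨T, hTS, hT⟩ := hμ.eq_one_of_forall_pos_eq hS fun T U hT hU =>
      huniq T U hT hU (fun e => h (by rwa [e] at hT)) (fun e => h (by rwa [e] at hU))
    exact hSX T hTS hT
  refine ⟨?_, hpos, (hμ.le_one hS subset_rfl).lt_of_ne (hSX S subset_rfl)⟩
  by_contra! h
  obtain ⟨A, B, C, hA, hB, hC, hAB, hAC, hBC⟩ := Finset.two_lt_card_iff.1 h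
  simp only [Finset.mem_filter] at hA hB hC
  by_cases hAS : A = S
  · exact hBC (huniq B C hB.2.2.1 hC.2.2.1 (hAS ▸ hAB.symm) (hAS ▸ hAC.symm))
  · by_cases hBS : B = S
    · exact hAC (huniq A C hA.2.2.1 hC.2.2.1 hAS (hBS ▸ hBC.symm))
    · exact hAB (huniq A B hA.2.2.1 hB.2.2.1 hAS hBS)
end

section
/- If a choice rule π satisfies regularity — that is, π(a|S) ≤ π(a|S−b) for every choice problem S and all distinct a, b ∈ S — then π has a RAM representation; in fact, for every preference ≻ on X there exists a monotonic attention rule μ such that (≻, μ) is a RAM representation of π. -/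
open Finset
open scoped Classical

variable {α : Type*} [Fintype α] [DecidableEq α]

/-- The attention rule that considers only the eventually chosen alternative: it puts weight
`π S a` on the singleton `{a}` for each `a ∈ S`, and no weight elsewhere. -/
noncomputable def singletonAttention {β : Type*} [DecidableEq β]
    (π : Finset β → β → ℝ) (S T : Finset β) : ℝ :=
  ∑ a ∈ S, if T = {a} then π S a else 0

theorem singletonAttention_singleton {β : Type*} [DecidableEq β]
    (π : Finset β → β → ℝ) {S : Finset β} {a : β}
    (ha : a ∈ S) : singletonAttention π S {a} = π S a := by
  simp [singletonAttention, ha]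

theorem singletonAttention_eq_zero {β : Type*} [DecidableEq β]
    (π : Finset β → β → ℝ) {S T : Finset β}
    (h : ∀ a ∈ S, T ≠ {a}) : singletonAttention π S T = 0 :=
  Finset.sum_eq_zero fun a ha => if_neg (h a ha)

theorem sum_powerset_singletonAttention {β : Type*} [DecidableEq β]
    (π : Finset β → β → ℝ) (S : Finset β) :
    ∑ T ∈ S.powerset, singletonAttention π S T = ∑ a ∈ S, π S a := by
  unfold singletonAttention
  rw [Finset.sum_comm]
  exact Finset.sum_congr rfl fun a ha => by simp [ha]

theorem isBest_singleton {β : Type*} {r : β → β → Prop} {a b : β} : IsBest r a {b} ↔ a = b := by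
  constructor
  · exact fun h => Finset.mem_singleton.mp h.1
  · rintro rfl
    exact ⟨Finset.mem_singleton_self a, fun b hb hne => absurd (Finset.mem_singleton.mp hb) hne⟩

theorem sum_isBest_singletonAttention {β : Type*} [DecidableEq β]
    (π : Finset β → β → ℝ) (r : β → β → Prop)
    {S : Finset β} {a : β} (ha : a ∈ S) :
    (∑ T ∈ S.powerset, if IsBest r a T then singletonAttention π S T else 0) = π S a := by
  rw [Finset.sum_eq_single {a}]
  · rw [if_pos (isBest_singleton.mpr rfl), singletonAttention_singleton π ha]
  · intro T _ hT
    split_ifs with h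
    · refine singletonAttention_eq_zero π ?_
      rintro b - rfl
      exact hT (by rw [isBest_singleton.mp h])
    · rfl
  · intro h
    exact absurd (Finset.mem_powerset.mpr (Finset.singleton_subset_iff.mpr ha)) h

theorem IsChoiceRule.isAttentionRule_singletonAttention {β : Type*} [DecidableEq β]
    {π : Finset β → β → ℝ}
    (hπ : IsChoiceRule π) : IsAttentionRule (singletonAttention π) := by
  intro S hS
  obtain ⟨hnonneg, -, hsum⟩ := hπ S hS
  refine ⟨fun T _ _ => Finset.sum_nonneg fun a ha => ?_, fun T hT => ?_, ?_⟩
  · split_ifs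
    exacts [hnonneg a ha, le_rfl]
  · refine singletonAttention_eq_zero π ?_
    rintro a ha rfl
    exact hT ⟨Finset.singleton_subset_iff.mpr ha, Finset.singleton_nonempty a⟩
  · rw [sum_powerset_singletonAttention, hsum]

theorem monotonicAttention_singletonAttention {β : Type*} [DecidableEq β]
    {π : Finset β → β → ℝ}
    (hreg : ∀ S : Finset β, S.Nonempty → ∀ a ∈ S, ∀ b ∈ S, a ≠ b →
      π S a ≤ π (S.erase b) a) :
    MonotonicAttention (singletonAttention π) := by
  intro S T hS hTS _ b hb hbT
  by_cases h : ∃ a ∈ S, T = {a}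
  · obtain ⟨a, ha, rfl⟩ := h
    have hab : a ≠ b := fun e => hbT (Finset.mem_singleton.mpr e.symm)
    rw [singletonAttention_singleton π ha,
      singletonAttention_singleton π (Finset.mem_erase.mpr ⟨hab, ha⟩)]
    exact hreg S hS a ha b hb hab
  · push Not at h
    rw [singletonAttention_eq_zero π h,
      singletonAttention_eq_zero π fun a ha => h a (Finset.mem_of_mem_erase ha)]

theorem isPref_wellOrderingRel {β : Type*} : IsPref (WellOrderingRel : β → β → Prop) where
  asymm _ _ := asymm
  trans _ _ _ := _root_.trans
  total a b hab := (trichotomous_of WellOrderingRel a b).imp_right fun h => h.resolve_left hab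

/-- If `π` satisfies regularity (`π(a|S) ≤ π(a|S−b)` for all
choice problems `S` and distinct `a, b ∈ S`), then `π` has a RAM
representation; in fact, for every preference `≻` there is a monotonic
attention rule `μ` such that `(≻, μ)` is a RAM representation of `π`. -/
theorem stmt13 (π : Finset α → α → ℝ) (hπ : IsChoiceRule π)
    (hreg : ∀ S : Finset α, S.Nonempty → ∀ a ∈ S, ∀ b ∈ S, a ≠ b →
      π S a ≤ π (S.erase b) a) :
    (∃ (r : α → α → Prop) (μ : Finset α → Finset α → ℝ), IsRAM π r μ) ∧
      ∀ r : α → α → Prop, IsPref r →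
        ∃ μ : Finset α → Finset α → ℝ, IsRAM π r μ := by
  have key : ∀ r : α → α → Prop, IsPref r → IsRAM π r (singletonAttention π) := fun r hr =>
    ⟨⟨hπ, hr, hπ.isAttentionRule_singletonAttention,
      fun S _ a ha => (sum_isBest_singletonAttention π r ha).symm⟩,
      monotonicAttention_singletonAttention hreg⟩
  exact ⟨⟨_, _, key _ isPref_wellOrderingRel⟩, fun r hr => ⟨_, key r hr⟩⟩
end
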